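/- Let p be a prime. There is no free action of the group (ℤ/pℤ) × (ℤ/pℤ) on the 3-sphere S³ by homeomorphisms. That is, there is no group action of (ZMod p) × (ZMod p) on the unit sphere S³ = {x ∈ ℝ⁴ : ‖x‖ = 1} by continuous maps (equivalently, by homeomorphisms) such that every element other than the identity acts without fixed points. -/

import Mathlib

namespace QuaternionSphere

open Topology Quaternion

section

abbrev S3 : Type := Metric.sphere (0 : Quaternion ℝ) 1

/-- Normalization of a nowhere vanishing map. -/
noncomputable def nrm {X : Type*} [TopologicalSpace X] (g : C(X, Quaternion ℝ)) (h : ∀ x, g x ≠ 0) :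
    C(X, S3) where
  toFun x := ⟨‖g x‖⁻¹ • g x, by
    have := norm_ne_zero_iff.2 (h x)
    simp [norm_smul, this]⟩
  continuous_toFun := by
    have : ∀ x, ‖g x‖ ≠ 0 := fun x => norm_ne_zero_iff.2 (h x)
    refine Continuous.subtype_mk ?_ _
    exact (g.continuous.norm.inv₀ this).smul g.continuous

theorem nrm_coe {X : Type*} [TopologicalSpace X] (g : C(X, Quaternion ℝ)) (h : ∀ x, g x ≠ 0) (x : X) :
    (nrm g h x : Quaternion ℝ) = ‖g x‖⁻¹ • g x := rfl

theorem S3_norm (x : S3) : ‖(x : Quaternion ℝ)‖ = 1 := by simp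
theorem S3_ne (x : S3) : (x : Quaternion ℝ) ≠ 0 := by
  intro h; have := S3_norm x; rw [h] at this; simp at this

theorem nrm_eq_of_pos {X : Type*} [TopologicalSpace X] (g : C(X, Quaternion ℝ)) (h : ∀ x, g x ≠ 0) (x : X)
    (r : ℝ) (hr : 0 < r) (y : S3) (e : g x = r • (y : Quaternion ℝ)) : nrm g h x = y := by
  apply Subtype.ext
  rw [nrm_coe, e, norm_smul, S3_norm, smul_smul]
  simp [abs_of_pos hr, hr.ne']

theorem homotopic_of {X Y : Type*} [TopologicalSpace X] [TopologicalSpace Y] {f g : C(X, Y)}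
    (F : unitInterval × X → Y) (hF : Continuous F) (h0 : ∀ x, F (0, x) = f x) (h1 : ∀ x, F (1, x) = g x) :
    f.Homotopic g := ⟨⟨⟨F, hF⟩, h0, h1⟩⟩

theorem nrm_homotopic {X : Type*} [TopologicalSpace X] (F : C(unitInterval × X, Quaternion ℝ))
    (hF : ∀ y, F y ≠ 0) (g g' : C(X, Quaternion ℝ)) (h : ∀ x, g x ≠ 0) (h' : ∀ x, g' x ≠ 0)
    (h0 : ∀ x, F (0, x) = g x) (h1 : ∀ x, F (1, x) = g' x) : (nrm g h).Homotopic (nrm g' h') := by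
  refine homotopic_of (nrm F hF) (nrm F hF).continuous ?_ ?_ <;> intro x <;> apply Subtype.ext <;>
   simp [nrm_coe, h0, h1]

theorem nrm_homotopic_line {X : Type*} [TopologicalSpace X] (g g' : C(X, Quaternion ℝ))
    (h : ∀ x, g x ≠ 0) (h' : ∀ x, g' x ≠ 0)
    (hh : ∀ x, ∀ t : ℝ, 0 ≤ t → t ≤ 1 → (1 - t) • g x + t • g' x ≠ 0) :
    (nrm g h).Homotopic (nrm g' h') := by
  refine nrm_homotopic ⟨fun y => (1 - (y.1 : ℝ)) • g y.2 + (y.1 : ℝ) • g' y.2, by fun_prop⟩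
    (fun y => hh _ _ y.1.2.1 y.1.2.2) _ _ _ _ ?_ ?_ <;> simp

theorem line_ne_zero_of_lt {E : Type*} [NormedAddCommGroup E] [NormedSpace ℝ E] {a b : E} (h : ‖a - b‖ < ‖a‖) {t : ℝ}
    (h0 : 0 ≤ t) (h1 : t ≤ 1) : (1 - t) • a + t • b ≠ 0 := by
  intro e
  have : a = t • (a - b) := by
    have : (1 - t) • a + t • b = a - t • (a - b) := by module
    rw [this] at e; exact sub_eq_zero.1 e
  have h3 : ‖a‖ = t * ‖a - b‖ := by
    conv_lhs => rw [this]
    rw [norm_smul, Real.norm_of_nonneg h0]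
  nlinarith [norm_nonneg (a - b)]

section quot
variable {X : Type*} [TopologicalSpace X]

theorem homotopic_mul {f f' g g' : C(X, S3)} (h : f.Homotopic f') (k : g.Homotopic g') :
    (f * g).Homotopic (f' * g') := by
  obtain ⟨H⟩ := h
  obtain ⟨K⟩ := k
  exact homotopic_of (fun y => H y * K y) (by fun_prop) (by simp) (by simp)

theorem homotopic_inv {f f' : C(X, S3)} (h : f.Homotopic f') : (f⁻¹).Homotopic f'⁻¹ := by
  obtain ⟨H⟩ := h
  exact homotopic_of (fun y => (H y)⁻¹) (by fun_prop) (by simp) (by simp)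

variable (X) in
/-- The null-homotopic maps. -/
def nullSub : Subgroup C(X, S3) where
  carrier := {f | f.Homotopic 1}
  one_mem' := ContinuousMap.Homotopic.refl _
  mul_mem' := fun h k => by simpa using homotopic_mul h k
  inv_mem' := fun h => by simpa using homotopic_inv h

instance : (nullSub X).Normal where
  conj_mem := fun f hf g => by
    have := homotopic_mul (homotopic_mul (ContinuousMap.Homotopic.refl g) hf) (ContinuousMap.Homotopic.refl g⁻¹)
    simpa [nullSub] using this

variable (X) in
def Coh : Type _ := C(X, S3) ⧸ nullSub X

noncomputable instance : Group (Coh X) := inferInstanceAs (Group (C(X, S3) ⧸ nullSub X))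

/-- The homotopy class of a map to the sphere. -/
noncomputable def cls : C(X, S3) →* Coh X := QuotientGroup.mk' _

theorem cls_eq_iff {f g : C(X, S3)} : cls f = cls g ↔ f.Homotopic g := by
  refine QuotientGroup.eq.trans ?_
  constructor
  · intro h
    have := homotopic_mul (ContinuousMap.Homotopic.refl f) (show (f⁻¹ * g).Homotopic 1 from h)
    simpa using this.symm
  · intro h
    change (f⁻¹ * g).Homotopic 1
    have := homotopic_mul (ContinuousMap.Homotopic.refl f⁻¹) h
    simpa using this.symm

theorem cls_surj (a : Coh X) : ∃ f, cls f = a := QuotientGroup.mk'_surjective _ a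

variable {Y : Type*} [TopologicalSpace Y]

noncomputable def compHom (e : C(X, Y)) : C(Y, S3) →* C(X, S3) where
  toFun f := f.comp e
  map_one' := rfl
  map_mul' _ _ := rfl

/-- Precomposition on homotopy classes. -/
noncomputable def pull (e : C(X, Y)) : Coh Y →* Coh X :=
  QuotientGroup.map _ _ (compHom e) (by
    intro f hf
    exact ContinuousMap.Homotopic.comp hf (ContinuousMap.Homotopic.refl e))

theorem pull_cls (e : C(X, Y)) (f : C(Y, S3)) : pull e (cls f) = cls (f.comp e) := rfl

end quot

end

section

theorem exists_not_mem_image_S3 {q : Quaternion ℝ → Quaternion ℝ} (hq : ContDiff ℝ 1 q) {ε : ℝ} (hε : 0 < ε) :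
    ∃ v, ‖v‖ < ε ∧ ∀ x : S3, q x ≠ v := by
  let _ : MeasurableSpace (Quaternion ℝ) := borel _
  have : BorelSpace (Quaternion ℝ) := ⟨rfl⟩
  have h0 : MeasureTheory.Measure.addHaar (G := Quaternion ℝ) (q '' Metric.sphere 0 1) = 0 := by
    apply MeasureTheory.addHaar_image_eq_zero_of_differentiableOn_of_addHaar_eq_zero
    · exact (hq.differentiable one_ne_zero).differentiableOn
    · exact MeasureTheory.Measure.addHaar_sphere _ _ _
  have h1 : ¬ (Metric.ball (0 : Quaternion ℝ) ε ⊆ q '' Metric.sphere 0 1) := by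
    intro h
    have := MeasureTheory.measure_mono_null h h0
    exact (Metric.measure_ball_pos MeasureTheory.Measure.addHaar (0 : Quaternion ℝ) hε).ne' this
  obtain ⟨v, hv, hv'⟩ := Set.not_subset.1 h1
  exact ⟨v, by simpa using hv, fun x e => hv' ⟨x, x.2, e⟩⟩

theorem extend_S3 {A : Set S3} (hA : IsClosed A) (φ : S3 → S3) (hφ : ContinuousOn φ A) :
    ∃ Φ : C(S3, S3), Set.EqOn Φ φ A := by
  obtain ⟨g, hg⟩ := ContinuousMap.exists_restrict_eq hA
    (⟨fun a : A => (φ a : Quaternion ℝ), (continuous_subtype_val.comp hφ.domRestrict)⟩ : C(A, Quaternion ℝ))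
  have hg' : ∀ a ∈ A, g a = φ a := fun a ha => DFunLike.congr_fun hg ⟨a, ha⟩
  obtain ⟨G, hG⟩ := ContinuousMap.exists_restrict_eq (s := Metric.sphere (0 : Quaternion ℝ) 1) Metric.isClosed_sphere g
  have hG' : ∀ a : S3, G a = g a := fun a => DFunLike.congr_fun hG a
  obtain ⟨q, hq, hqG, -⟩ := G.continuous.exists_contDiff_approx 1 (ε := fun _ => 1 / 8) continuous_const
    (fun _ => by norm_num)
  obtain ⟨v, hv, hqv⟩ := exists_not_mem_image_S3 hq (ε := 1 / 8) (by norm_num)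
  have hnear : ∀ x : S3, ‖(q x - v) - g x‖ < 1 / 4 := by
    intro x
    have h1 := hqG x
    rw [dist_eq_norm, hG'] at h1
    calc ‖(q x - v) - g x‖ = ‖(q x - g x) - v‖ := by congr 1; abel
      _ ≤ ‖q x - g x‖ + ‖v‖ := norm_sub_le _ _
      _ < 1 / 4 := by linarith
  let l : S3 → ℝ := fun x => max 0 (min 1 (2 * ‖g x‖ - 1))
  have hl : Continuous l := by fun_prop
  have hqc : Continuous fun x : S3 => q x := hq.continuous.comp continuous_subtype_val
  let u : C(S3, Quaternion ℝ) := ⟨fun x => (1 - l x) • (q x - v) + l x • g x, by fun_prop⟩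
  have hu : ∀ x, u x ≠ 0 := by
    intro x
    by_cases hx : ‖g x‖ ≤ 1 / 2
    · have : l x = 0 := max_eq_left (le_trans (min_le_right _ _) (by linarith))
      simpa [u, this, sub_eq_zero] using hqv x
    · push Not at hx
      have h1 : 0 ≤ l x := le_max_left _ _
      have h2 : l x ≤ 1 := max_le zero_le_one (min_le_left _ _)
      have := line_ne_zero_of_lt (a := g x) (b := q x - v) (t := 1 - l x)
        (by rw [norm_sub_rev]; linarith [hnear x]) (by linarith) (by linarith)
      intro e
      apply this
      refine Eq.trans ?_ e
      simp only [u, ContinuousMap.coe_mk]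
      module
  refine ⟨nrm u hu, fun a ha => nrm_eq_of_pos u hu a 1 one_pos _ ?_⟩
  have : l a = 1 := by
    simp only [l, hg' a ha, S3_norm]; norm_num
  simp [u, this, hg' a ha]

/-- A free action of an additive group by continuous maps. -/
structure IsFreeAct {G X : Type*} [AddGroup G] [TopologicalSpace X] (act : G → X → X) : Prop where
  cont : ∀ g, Continuous (act g)
  zero : ∀ x, act 0 x = x
  add : ∀ g h x, act (g + h) x = act g (act h x)
  free : ∀ g, g ≠ 0 → ∀ x, act g x ≠ x

section
variable {G : Type*} [AddGroup G] [Finite G] {act : G → S3 → S3}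

theorem exists_disjoint_nhd (h : IsFreeAct act) (x : S3) :
    ∃ U B : Set S3, IsOpen U ∧ IsClosed B ∧ B ⊆ U ∧ B ∈ 𝓝 x ∧ ∀ g, g ≠ 0 → ∀ y ∈ U, act g y ∉ U := by
  have key : ∀ g : G, ∃ V ∈ 𝓝 x, g ≠ 0 → ∀ y ∈ V, act g y ∉ V := by
    intro g
    by_cases hg : g = 0
    · exact ⟨Set.univ, Filter.univ_mem, fun h => absurd hg h⟩
    · obtain ⟨V1, V2, h1, h2, hx1, hx2, hd⟩ := t2_separation (h.free g hg x)
      refine ⟨act g ⁻¹' V1 ∩ V2, Filter.inter_mem ((h1.preimage (h.cont g)).mem_nhds hx1) (h2.mem_nhds hx2), ?_⟩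
      intro _ y hy hy'
      exact Set.disjoint_left.1 hd hy.1 hy'.2
  choose V hV hV' using key
  have hI : (⋂ g, V g) ∈ 𝓝 x := Filter.iInter_mem.2 hV
  obtain ⟨U, hU, hUo, hxU⟩ := mem_nhds_iff.1 hI
  obtain ⟨B, hB, hBc, hBU⟩ := exists_mem_nhds_isClosed_subset (hUo.mem_nhds hxU)
  exact ⟨U, B, hUo, hBc, hBU, hB, fun g hg y hy hy' =>
    hV' g hg y (Set.mem_iInter.1 (hU hy) g) (Set.mem_iInter.1 (hU hy') g)⟩

theorem free_induction (h : IsFreeAct act) (P : Set S3 → Prop) (h0 : P ∅)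
    (hstep : ∀ C U B : Set S3, IsClosed C → (∀ g, ∀ x ∈ C, act g x ∈ C) → IsOpen U → IsClosed B → B ⊆ U →
      (∀ g, g ≠ 0 → ∀ y ∈ U, act g y ∉ U) → P C → P (C ∪ ⋃ g, act g ⁻¹' B)) : P Set.univ := by
  choose U B hU hB hBU hx hd using exists_disjoint_nhd h
  obtain ⟨t, ht⟩ := (CompactSpace.elim_nhds_subcover B hx)
  have key : ∀ s : Finset S3, ∃ C, IsClosed C ∧ (∀ g, ∀ x ∈ C, act g x ∈ C) ∧ (⋃ x ∈ s, B x) ⊆ C ∧ P C := by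
    intro s
    classical
    induction s using Finset.induction_on with
    | empty => exact ⟨∅, isClosed_empty, by simp, by simp, h0⟩
    | insert a s ha ih =>
      obtain ⟨C, h1, h2, h3, h4⟩ := ih
      refine ⟨_, ?_, ?_, ?_, hstep C (U a) (B a) h1 h2 (hU a) (hB a) (hBU a) (hd a) h4⟩
      · exact h1.union (isClosed_iUnion_of_finite fun g => (hB a).preimage (h.cont g))
      · rintro g x (hx | hx)
        · exact Or.inl (h2 g x hx)
        · obtain ⟨k, hk⟩ := Set.mem_iUnion.1 hx
          refine Or.inr (Set.mem_iUnion.2 ⟨k - g, ?_⟩)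
          change act (k - g) (act g x) ∈ B a
          rw [← h.add]; simpa using hk
      · rw [Finset.set_biUnion_insert]
        refine Set.union_subset ?_ (h3.trans Set.subset_union_left)
        refine Set.Subset.trans ?_ Set.subset_union_right
        intro y hy
        refine Set.mem_iUnion.2 ⟨0, ?_⟩
        simpa [h.zero] using hy
  obtain ⟨C, -, -, h3, h4⟩ := key t
  have : C = Set.univ := Set.eq_univ_of_univ_subset (ht.symm.subset.trans h3)
  exact this ▸ h4

/-- A free action of a finite group on the sphere maps equivariantly to every action on the sphere. -/
theorem exists_equivariant (h : IsFreeAct act) (act' : G → S3 → S3) (hc : ∀ g, Continuous (act' g))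
    (hz : ∀ x, act' 0 x = x) (hadd : ∀ g k x, act' (g + k) x = act' g (act' k x)) :
    ∃ f : C(S3, S3), ∀ g x, f (act g x) = act' g (f x) := by
  have := free_induction h (P := fun C => ∃ f : S3 → S3, ContinuousOn f C ∧ ∀ g, ∀ x ∈ C, f (act g x) = act' g (f x))
    ⟨id, by simp, by simp⟩ ?_
  · obtain ⟨f, hf, hf'⟩ := this
    exact ⟨⟨f, continuousOn_univ.1 hf⟩, fun g x => hf' g x trivial⟩
  rintro C U B hC hCi hU hB hBU hd ⟨f, hf, hfe⟩
  obtain ⟨Φ, hΦ⟩ := extend_S3 hC f hf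
  classical
  have huniq : ∀ x g k, act g x ∈ B → act k x ∈ B → g = k := by
    intro x g k hg hk
    by_contra hne
    have := hd (k - g) (fun e => hne (sub_eq_zero.1 e).symm) _ (hBU hg)
    rw [← h.add] at this
    exact this (hBU (by simpa using hk))
  let F : S3 → S3 := fun x => if hx : ∃ g, act g x ∈ B then act' (-hx.choose) (Φ (act hx.choose x)) else f x
  have hF1 : ∀ x g, act g x ∈ B → F x = act' (-g) (Φ (act g x)) := by
    intro x g hg
    have hx : ∃ g, act g x ∈ B := ⟨g, hg⟩
    have : hx.choose = g := huniq x _ _ hx.choose_spec hg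
    simp only [F, dif_pos hx, this]
  have hF2 : ∀ x ∈ C, F x = f x := by
    intro x hx
    by_cases hx' : ∃ g, act g x ∈ B
    · obtain ⟨g, hg⟩ := hx'
      rw [hF1 x g hg, hΦ (hCi g x hx), hfe g x hx, ← hadd]; simp [hz]
    · simp only [F, dif_neg hx']
  refine ⟨F, ?_, ?_⟩
  · refine ContinuousOn.union_of_isClosed (hf.congr hF2) ?_ hC
      (isClosed_iUnion_of_finite fun g => (hB).preimage (h.cont g))
    apply LocallyFinite.continuousOn_iUnion (locallyFinite_of_finite _) fun g => (hB).preimage (h.cont g)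
    intro g
    refine ContinuousOn.congr (f := fun x => act' (-g) (Φ (act g x))) ?_ (fun x hx => hF1 x g hx)
    exact ((hc _).comp (Φ.continuous.comp (h.cont g))).continuousOn
  · rintro g x (hx | hx)
    · rw [hF2 x hx, hF2 _ (hCi g x hx), hfe g x hx]
    · obtain ⟨k, hk⟩ := Set.mem_iUnion.1 hx
      have hk' : act (k - g) (act g x) ∈ B := by rw [← h.add]; simpa using hk
      rw [hF1 x k hk, hF1 _ _ hk', ← hadd, ← h.add]; simp [sub_eq_add_neg]

theorem list_prod_eq_single {ι M : Type*} [Monoid M] (l : List ι) (hl : l.Nodup) (f : ι → M) (i : ι)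
    (hi : i ∈ l) (h : ∀ j ∈ l, j ≠ i → f j = 1) : (l.map f).prod = f i := by
  induction l with
  | nil => simp at hi
  | cons a l ih =>
    rw [List.map_cons, List.prod_cons]
    rw [List.nodup_cons] at hl
    by_cases ha : i = a
    · subst ha
      rw [List.prod_eq_one, mul_one]
      simp only [List.mem_map]
      rintro x ⟨j, hj, rfl⟩
      exact h j (by simp [hj]) (fun e => hl.1 (e ▸ hj))
    · rw [h a (by simp) (Ne.symm ha), one_mul,
        ih hl.2 ((List.mem_cons.1 hi).resolve_left ha) fun j hj => h j (by simp [hj])]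

/-- The class of an invariant map lies in every subgroup containing all norms. -/
theorem cls_mem_of_invariant [Fintype G] (h : IsFreeAct act) (N : Subgroup (Coh S3))
    (hN : ∀ q : C(S3, S3), ((Finset.univ.toList : List G).map fun g => cls (q.comp ⟨act g, h.cont g⟩)).prod ∈ N)
    (D : C(S3, S3)) (hD : ∀ g x, D (act g x) = D x) : cls D ∈ N := by
  have := free_induction h (P := fun C => ∃ D' : C(S3, S3), (∀ g x, D' (act g x) = D' x) ∧ (∀ x ∈ C, D' x = 1) ∧
    (cls D' ∈ N → cls D ∈ N)) ⟨D, hD, by simp, id⟩ ?_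
  · obtain ⟨D', -, h2, h3⟩ := this
    have : D' = 1 := ContinuousMap.ext fun x => h2 x trivial
    apply h3
    rw [this, map_one]
    exact N.one_mem
  rintro C U B hC hCi hU hB hBU hd ⟨D', h1, h2, h3⟩
  classical
  obtain ⟨q, hq⟩ := extend_S3 (A := B ∪ (Uᶜ ∪ C)) (hB.union (hU.isClosed_compl.union hC))
    (fun x => if x ∈ B then D' x else 1) (by
      refine ContinuousOn.union_of_isClosed ?_ ?_ hB (hU.isClosed_compl.union hC)
      · exact D'.continuous.continuousOn.congr fun x hx => if_pos hx
      · refine (continuousOn_const (c := (1 : S3))).congr fun x hx => ?_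
        rcases hx with hx | hx
        · exact if_neg fun hx' => hx (hBU hx')
        · simp only [h2 x hx, ite_self])
  have hqB : ∀ x ∈ B, q x = D' x := fun x hx => (hq (Or.inl hx)).trans (if_pos hx)
  have hqC : ∀ x ∈ C, q x = 1 := fun x hx => (hq (Or.inr (Or.inr hx))).trans (by simp [h2 x hx])
  have hqU : ∀ x ∉ U, q x = 1 := fun x hx => (hq (Or.inr (Or.inl hx))).trans (if_neg fun hx' => hx (hBU hx'))
  let P : C(S3, S3) := ((Finset.univ.toList : List G).map fun g => q.comp ⟨act g, h.cont g⟩).prod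
  have hPx : ∀ x, P x = ((Finset.univ.toList : List G).map fun g => q (act g x)).prod := by
    intro x
    let ev : C(S3, S3) →* S3 := ⟨⟨fun f => f x, rfl⟩, fun _ _ => rfl⟩
    have : ev P = _ := map_list_prod ev _
    rw [List.map_map] at this
    exact this
  have hPU : ∀ x g, act g x ∈ U → P x = q (act g x) := by
    intro x g hg
    rw [hPx]
    refine list_prod_eq_single _ (Finset.nodup_toList _) _ g (by simp) fun j _ hj => ?_
    apply hqU
    have := hd (j - g) (sub_ne_zero.2 hj) _ hg
    rw [← h.add] at this
    simpa using this
  have hPU' : ∀ x, (∀ g, act g x ∉ U) → P x = 1 := by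
    intro x hx
    rw [hPx]
    apply List.prod_eq_one
    simp only [List.mem_map]
    rintro _ ⟨j, -, rfl⟩
    exact hqU _ (hx j)
  have hPC : ∀ x ∈ C, P x = 1 := by
    intro x hx
    rw [hPx]
    apply List.prod_eq_one
    simp only [List.mem_map]
    rintro _ ⟨j, -, rfl⟩
    exact hqC _ (hCi j x hx)
  have hPi : ∀ g x, P (act g x) = P x := by
    intro g x
    by_cases hx : ∃ k, act k x ∈ U
    · obtain ⟨k, hk⟩ := hx
      have e : act (k - g) (act g x) = act k x := by rw [← h.add]; simp
      rw [hPU x k hk, hPU _ (k - g) (e ▸ hk), e]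
    · push Not at hx
      rw [hPU' x hx, hPU']
      intro k
      rw [← h.add]; exact hx _
  have hPN : cls P ∈ N := by
    have := hN q
    have e : cls P = _ := map_list_prod cls _
    rw [List.map_map] at e
    rw [e]
    exact this
  refine ⟨D' * P⁻¹, ?_, ?_, ?_⟩
  · intro g x
    simp [h1, hPi]
  · rintro x (hx | hx)
    · simp [h2 x hx, hPC x hx]
    · obtain ⟨g, hg⟩ := Set.mem_iUnion.1 hx
      have : P x = D' x := by rw [hPU x g (hBU hg), hqB _ hg, h1]
      simp [this]
  · intro hh
    apply h3
    rw [map_mul, map_inv] at hh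
    have := N.mul_mem hh hPN
    rwa [inv_mul_cancel_right] at this

end

end

section

/-- `M` is joined to `1` or `-1` through invertible matrices. -/
def JoinedSign (M : Matrix (Fin 3) (Fin 3) ℝ) : Prop :=
  ∃ γ : ℝ → Matrix (Fin 3) (Fin 3) ℝ, Continuous γ ∧ (∀ t, 0 ≤ t → t ≤ 1 → (γ t).det ≠ 0) ∧ γ 0 = M ∧
    (γ 1 = 1 ∨ γ 1 = -1)

theorem JoinedSign.mul {A B : Matrix (Fin 3) (Fin 3) ℝ} (hA : JoinedSign A) (hB : JoinedSign B) :
    JoinedSign (A * B) := by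
  obtain ⟨γ, h1, h2, h3, h4⟩ := hA
  obtain ⟨δ, k1, k2, k3, k4⟩ := hB
  refine ⟨fun t => γ t * δ t, h1.matrix_mul k1, fun t a b => ?_, by simp [h3, k3], ?_⟩
  · rw [Matrix.det_mul]; exact mul_ne_zero (h2 t a b) (k2 t a b)
  · rcases h4 with h4 | h4 <;> rcases k4 with k4 | k4 <;> simp [h4, k4]

theorem joinedSign_one : JoinedSign 1 := ⟨fun _ => 1, continuous_const, by simp, rfl, Or.inl rfl⟩

theorem joinedSign_diag_pos (D : Fin 3 → ℝ) (hD : ∀ i, 0 < D i) : JoinedSign (Matrix.diagonal D) := by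
  refine ⟨fun t => Matrix.diagonal fun i => (1 - t) * D i + t, ?_, ?_, by simp, Or.inl ?_⟩
  · exact Continuous.matrix_diagonal (by fun_prop)
  · intro t h0 h1
    rw [Matrix.det_diagonal]
    refine (Finset.prod_pos fun i _ => ?_).ne'
    rcases eq_or_lt_of_le h0 with rfl | h
    · simpa using hD i
    · nlinarith [hD i]
  · ext i j; simp [Matrix.diagonal, Matrix.one_apply]

theorem joinedSign_flip0 : JoinedSign (Matrix.diagonal ![-1, 1, 1]) := by
  refine ⟨fun t => !![-1, 0, 0; 0, Real.cos (Real.pi * t), -Real.sin (Real.pi * t);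
    0, Real.sin (Real.pi * t), Real.cos (Real.pi * t)], ?_, ?_, ?_, Or.inr ?_⟩
  · refine continuous_matrix fun i j => ?_
    fin_cases i <;> fin_cases j <;> simp <;> fun_prop
  · intro t _ _
    rw [Matrix.det_fin_three]
    simp
    nlinarith [Real.sin_sq_add_cos_sq (Real.pi * t)]
  · ext i j; fin_cases i <;> fin_cases j <;> simp
  · ext i j; fin_cases i <;> fin_cases j <;> simp

theorem joinedSign_flip1 : JoinedSign (Matrix.diagonal ![1, -1, 1]) := by
  refine ⟨fun t => !![Real.cos (Real.pi * t), 0, -Real.sin (Real.pi * t); 0, -1, 0;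
    Real.sin (Real.pi * t), 0, Real.cos (Real.pi * t)], ?_, ?_, ?_, Or.inr ?_⟩
  · refine continuous_matrix fun i j => ?_
    fin_cases i <;> fin_cases j <;> simp <;> fun_prop
  · intro t _ _
    rw [Matrix.det_fin_three]
    simp
    nlinarith [Real.sin_sq_add_cos_sq (Real.pi * t)]
  · ext i j; fin_cases i <;> fin_cases j <;> simp
  · ext i j; fin_cases i <;> fin_cases j <;> simp

theorem joinedSign_flip2 : JoinedSign (Matrix.diagonal ![1, 1, -1]) := by
  refine ⟨fun t => !![Real.cos (Real.pi * t), -Real.sin (Real.pi * t), 0;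
    Real.sin (Real.pi * t), Real.cos (Real.pi * t), 0; 0, 0, -1], ?_, ?_, ?_, Or.inr ?_⟩
  · refine continuous_matrix fun i j => ?_
    fin_cases i <;> fin_cases j <;> simp <;> fun_prop
  · intro t _ _
    rw [Matrix.det_fin_three]
    simp
    nlinarith [Real.sin_sq_add_cos_sq (Real.pi * t)]
  · ext i j; fin_cases i <;> fin_cases j <;> simp
  · ext i j; fin_cases i <;> fin_cases j <;> simp

theorem joinedSign_of_det_ne_zero (M : Matrix (Fin 3) (Fin 3) ℝ) (hM : M.det ≠ 0) : JoinedSign M := by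
  refine Matrix.diagonal_transvection_induction_of_det_ne_zero JoinedSign M hM ?_ ?_ ?_
  · intro D hD
    rw [Matrix.det_diagonal, Finset.prod_ne_zero_iff] at hD
    have sgn : ∀ v : Fin 3 → ℝ, JoinedSign (Matrix.diagonal v) → ∀ c : ℝ, c ≠ 0 → JoinedSign (Matrix.diagonal
        fun i => if 0 < c then 1 else v i) := by
      intro v hv c hc
      by_cases h : 0 < c
      · simpa [h] using joinedSign_one
      · simpa [h] using hv
    have h := (((joinedSign_diag_pos (fun i => |D i|) fun i => abs_pos.2 (hD i (by simp))).mul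
      (sgn _ joinedSign_flip0 (D 0) (hD 0 (by simp)))).mul
      (sgn _ joinedSign_flip1 (D 1) (hD 1 (by simp)))).mul
      (sgn _ joinedSign_flip2 (D 2) (hD 2 (by simp)))
    convert h using 1
    rw [Matrix.diagonal_mul_diagonal, Matrix.diagonal_mul_diagonal, Matrix.diagonal_mul_diagonal]
    congr 1
    ext i
    clear h
    fin_cases i <;> simp <;> split_ifs with hc
    all_goals first | rw [abs_of_pos hc] | rw [abs_of_nonpos (not_lt.1 hc), neg_neg]
  · intro t
    refine ⟨fun s => Matrix.transvection t.i t.j ((1 - s) * t.c), ?_, ?_, ?_, Or.inl ?_⟩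
    · unfold Matrix.transvection
      refine continuous_matrix fun i j => ?_
      simp only [Matrix.add_apply, Matrix.single_apply]
      split_ifs <;> fun_prop
    · intro s _ _
      rw [Matrix.det_transvection_of_ne _ _ t.hij]; exact one_ne_zero
    · simp [Matrix.TransvectionStruct.toMatrix]
    · simp
  · intro A B _ _ hA hB
    exact hA.mul hB

end

section

abbrev E3 : Type := Fin 3 → ℝ

/-- The quaternion with given real and imaginary parts. -/
def qt (a : ℝ) (v : E3) : Quaternion ℝ := ⟨a, v 0, v 1, v 2⟩

@[simp] theorem qt_re (a : ℝ) (v : E3) : (qt a v).re = a := rfl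
@[simp] theorem qt_imI (a : ℝ) (v : E3) : (qt a v).imI = v 0 := rfl
@[simp] theorem qt_imJ (a : ℝ) (v : E3) : (qt a v).imJ = v 1 := rfl
@[simp] theorem qt_imK (a : ℝ) (v : E3) : (qt a v).imK = v 2 := rfl

theorem continuous_of_components {X : Type*} [TopologicalSpace X] {f : X → Quaternion ℝ}
    (h0 : Continuous fun x => (f x).re) (h1 : Continuous fun x => (f x).imI)
    (h2 : Continuous fun x => (f x).imJ) (h3 : Continuous fun x => (f x).imK) : Continuous f := by
  have : f = fun x => (f x).re • (1 : Quaternion ℝ) + (f x).imI • qt 0 ![1, 0, 0] +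
      (f x).imJ • qt 0 ![0, 1, 0] + (f x).imK • qt 0 ![0, 0, 1] := by
    funext x; ext <;> simp
  rw [this]
  fun_prop

theorem continuous_qt {X : Type*} [TopologicalSpace X] {a : X → ℝ} {v : X → E3} (ha : Continuous a)
    (hv : Continuous v) : Continuous fun x => qt (a x) (v x) := by
  apply continuous_of_components <;> simp only [QuaternionSphere.qt] <;> fun_prop

theorem qt_ne_zero {a : ℝ} {v : E3} (h : a = 0 → v ≠ 0) : qt a v ≠ 0 := by
  intro e
  have h0 := congrArg QuaternionAlgebra.re e
  have h1 := congrArg QuaternionAlgebra.imI e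
  have h2 := congrArg QuaternionAlgebra.imJ e
  have h3 := congrArg QuaternionAlgebra.imK e
  simp only [qt] at h0 h1 h2 h3
  refine h h0 ?_
  ext i; fin_cases i
  exacts [h1, h2, h3]

theorem qt_one_zero : qt 1 0 = 1 := by ext <;> simp [qt]

theorem S3_sq (x : S3) : (x : Quaternion ℝ).re ^ 2 + (x : Quaternion ℝ).imI ^ 2 + (x : Quaternion ℝ).imJ ^ 2 +
    (x : Quaternion ℝ).imK ^ 2 = 1 := by
  have := Quaternion.normSq_eq_norm_mul_self (x : Quaternion ℝ)
  rw [S3_norm, Quaternion.normSq_def'] at this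
  linarith

/-- Stereographic projection from `-1`. -/
noncomputable def chart (x : Quaternion ℝ) : E3 := ![x.imI / (1 + x.re), x.imJ / (1 + x.re), x.imK / (1 + x.re)]

/-- A map on `ℝ³` transported to the sphere by stereographic projection. -/
noncomputable def Traw (k : E3 → Quaternion ℝ) (x : S3) : Quaternion ℝ :=
  open Classical in if (x : Quaternion ℝ).re = -1 then 1 else k (chart x)

theorem continuous_Traw {Z : Type*} [TopologicalSpace Z] (K : Z × E3 → Quaternion ℝ) (hK : Continuous K) (R : ℝ)
    (hR : ∀ z v, R < ‖v‖ → K (z, v) = 1) : Continuous fun y : Z × S3 => Traw (fun v => K (y.1, v)) y.2 := by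
  have hre : Continuous fun y : Z × S3 => (y.2 : Quaternion ℝ).re :=
    Quaternion.continuous_re.comp (continuous_subtype_val.comp continuous_snd)
  have hi : Continuous fun y : Z × S3 => (y.2 : Quaternion ℝ).imI :=
    Quaternion.continuous_imI.comp (continuous_subtype_val.comp continuous_snd)
  have hj : Continuous fun y : Z × S3 => (y.2 : Quaternion ℝ).imJ :=
    Quaternion.continuous_imJ.comp (continuous_subtype_val.comp continuous_snd)
  have hk : Continuous fun y : Z × S3 => (y.2 : Quaternion ℝ).imK :=
    Quaternion.continuous_imK.comp (continuous_subtype_val.comp continuous_snd)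
  rw [continuous_iff_continuousAt]
  intro y
  by_cases hy : (y.2 : Quaternion ℝ).re = -1
  · have hopen : IsOpen {y : Z × S3 | 3 * R ^ 2 * (1 + (y.2 : Quaternion ℝ).re) < 1 - (y.2 : Quaternion ℝ).re} :=
      isOpen_lt (by fun_prop) (by fun_prop)
    have hmem : y ∈ {y : Z × S3 | 3 * R ^ 2 * (1 + (y.2 : Quaternion ℝ).re) < 1 - (y.2 : Quaternion ℝ).re} := by
      change 3 * R ^ 2 * (1 + (y.2 : Quaternion ℝ).re) < 1 - (y.2 : Quaternion ℝ).re
      rw [hy]; norm_num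
    refine (continuousAt_const (y := (1 : Quaternion ℝ))).congr ?_
    filter_upwards [hopen.mem_nhds hmem] with y hy
    by_cases hy' : (y.2 : Quaternion ℝ).re = -1
    · simp [Traw, hy']
    · simp only [Traw, if_neg hy']
      symm
      apply hR
      by_contra hcon
      push Not at hcon
      have hb : ∀ i, (chart y.2 i) ^ 2 ≤ R ^ 2 := fun i => by
        have := (norm_le_pi_norm (chart y.2) i).trans hcon
        rw [← sq_abs]
        exact pow_le_pow_left₀ (abs_nonneg _) this 2
      have h0 := hb 0
      have h1 := hb 1
      have h2 := hb 2
      simp only [chart, Matrix.cons_val, div_pow] at h0 h1 h2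
      have hsq := S3_sq y.2
      have hpos : 0 < 1 + (y.2 : Quaternion ℝ).re := by
        have : -1 ≤ (y.2 : Quaternion ℝ).re := by nlinarith [sq_nonneg (y.2 : Quaternion ℝ).imI, sq_nonneg (y.2 : Quaternion ℝ).imJ, sq_nonneg (y.2 : Quaternion ℝ).imK]
        rcases eq_or_lt_of_le this with h | h
        · exact absurd h.symm hy'
        · linarith
      rw [div_le_iff₀ (by positivity)] at h0 h1 h2
      change _ < _ at hy
      nlinarith
  · have h1 : 1 + (y.2 : Quaternion ℝ).re ≠ 0 := fun h => hy (by linarith)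
    have hc : ContinuousAt (fun y : Z × S3 => chart y.2) y := by
      refine continuousAt_pi.2 fun i => ?_
      fin_cases i
      · exact hi.continuousAt.div (continuous_const.add hre).continuousAt h1
      · exact hj.continuousAt.div (continuous_const.add hre).continuousAt h1
      · exact hk.continuousAt.div (continuous_const.add hre).continuousAt h1
    refine ContinuousAt.congr (f := fun y : Z × S3 => K (y.1, chart y.2)) ?_ ?_
    · exact hK.continuousAt.comp (continuousAt_fst.prodMk hc)
    · filter_upwards [(isOpen_ne.preimage hre).mem_nhds hy] with y hy
      simp only [Traw]
      rw [if_neg hy]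

theorem Traw_ne_zero {k : E3 → Quaternion ℝ} (hk : ∀ v, k v ≠ 0) (x : S3) : Traw k x ≠ 0 := by
  unfold Traw
  split_ifs
  · exact one_ne_zero
  · exact hk _

structure Adm (k : E3 → Quaternion ℝ) : Prop where
  cont : Continuous k
  ne : ∀ v, k v ≠ 0
  one : ∃ R : ℝ, ∀ v, R < ‖v‖ → k v = 1

theorem Adm.continuous_Traw {k : E3 → Quaternion ℝ} (h : Adm k) : Continuous (Traw k) := by
  obtain ⟨R, hR⟩ := h.one
  exact (QuaternionSphere.continuous_Traw (Z := Unit) (fun y => k y.2) (h.cont.comp continuous_snd) R fun _ => hR).comp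
    (continuous_const (y := ()) |>.prodMk continuous_id)

noncomputable def T (k : E3 → Quaternion ℝ) (h : Adm k) : C(S3, S3) :=
  nrm ⟨Traw k, h.continuous_Traw⟩ (Traw_ne_zero h.ne)

def Good (N : Subgroup (Coh S3)) (k : E3 → Quaternion ℝ) : Prop := ∃ h : Adm k, cls (T k h) ∈ N

variable {N : Subgroup (Coh S3)}

theorem good_of_homotopy (K : ℝ → E3 → Quaternion ℝ) (hK : Continuous fun y : ℝ × E3 => K y.1 y.2)
    (hne : ∀ t, 0 ≤ t → t ≤ 1 → ∀ v, K t v ≠ 0)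
    (hR : ∃ R : ℝ, ∀ t, 0 ≤ t → t ≤ 1 → ∀ v, R < ‖v‖ → K t v = 1) (h1 : Good N (K 1)) : Good N (K 0) := by
  obtain ⟨R, hR⟩ := hR
  obtain ⟨a1, h1⟩ := h1
  have a0 : Adm (K 0) := ⟨hK.comp (continuous_const.prodMk continuous_id), hne 0 le_rfl zero_le_one,
    R, hR 0 le_rfl zero_le_one⟩
  refine ⟨a0, ?_⟩
  rwa [show cls (T (K 0) a0) = cls (T (K 1) a1) from ?_]
  rw [cls_eq_iff]
  let F : C(unitInterval × S3, Quaternion ℝ) :=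
    ⟨_, continuous_Traw (Z := unitInterval) (fun y => K y.1 y.2) (by fun_prop) R
      fun t v hv => hR t t.2.1 t.2.2 v hv⟩
  refine nrm_homotopic F (fun y => Traw_ne_zero (hne y.1 y.1.2.1 y.1.2.2) y.2) _ _ _ _ ?_ ?_ <;> intro x <;> simp [F]

theorem good_of_line {k k' : E3 → Quaternion ℝ} (h1 : Good N k') (hk : Continuous k)
    (hR : ∃ R : ℝ, ∀ v, R < ‖v‖ → k v = 1)
    (hne : ∀ t : ℝ, 0 ≤ t → t ≤ 1 → ∀ v, (1 - t) • k v + t • k' v ≠ 0) : Good N k := by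
  obtain ⟨R, hR⟩ := hR
  obtain ⟨R', hR'⟩ := h1.1.one
  have hk' := h1.1.cont
  have := good_of_homotopy (N := N) (fun t v => (1 - t) • k v + t • k' v) (by fun_prop) hne
    ⟨max R R', fun t _ _ v hv => ?_⟩ (by simpa using h1)
  · simpa using this
  · rw [hR v (lt_of_le_of_lt (le_max_left _ _) hv), hR' v (lt_of_le_of_lt (le_max_right _ _) hv)]
    module

theorem good_one : Good N fun _ => 1 := by
  have h : Adm fun _ => 1 := ⟨continuous_const, fun _ => one_ne_zero, 0, fun _ _ => rfl⟩
  refine ⟨h, ?_⟩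
  have : T _ h = 1 := by
    ext1 x
    exact nrm_eq_of_pos _ _ x 1 one_pos _ (by simp [Traw])
  rw [this, map_one]; exact N.one_mem

theorem Good.mul {k k' : E3 → Quaternion ℝ} (h : Good N k) (h' : Good N k') : Good N (fun v => k v * k' v) := by
  obtain ⟨a, h⟩ := h
  obtain ⟨a', h'⟩ := h'
  have b : Adm (fun v => k v * k' v) := by
    refine ⟨a.cont.mul a'.cont, fun v => mul_ne_zero (a.ne v) (a'.ne v), ?_⟩
    obtain ⟨R, hR⟩ := a.one
    obtain ⟨R', hR'⟩ := a'.one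
    refine ⟨max R R', fun v hv => ?_⟩
    rw [hR v (lt_of_le_of_lt (le_max_left _ _) hv), hR' v (lt_of_le_of_lt (le_max_right _ _) hv), one_mul]
  refine ⟨b, ?_⟩
  have : T _ b = T _ a * T _ a' := by
    ext1 x
    apply Subtype.ext
    simp only [ContinuousMap.mul_apply, T, nrm_coe, ContinuousMap.coe_mk, Metric.unitSphere.coe_mul]
    have : Traw (fun v => k v * k' v) x = Traw k x * Traw k' x := by
      unfold Traw; split_ifs <;> simp
    rw [this, norm_mul, smul_mul_smul_comm, mul_inv]
  rw [this, map_mul]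
  exact N.mul_mem h h'

theorem Good.star {k : E3 → Quaternion ℝ} (h : Good N k) : Good N (fun v => star (k v)) := by
  obtain ⟨a, h⟩ := h
  have b : Adm (fun v => Star.star (k v)) := by
    refine ⟨a.cont.star, fun v => star_ne_zero.2 (a.ne v), ?_⟩
    obtain ⟨R, hR⟩ := a.one
    exact ⟨R, fun v hv => by simp [hR v hv]⟩
  refine ⟨b, ?_⟩
  have : T _ b = (T _ a)⁻¹ := by
    rw [eq_inv_iff_mul_eq_one]
    ext1 x
    apply Subtype.ext
    simp only [ContinuousMap.mul_apply, T, nrm_coe, ContinuousMap.coe_mk, Metric.unitSphere.coe_mul]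
    have : Traw (fun v => Star.star (k v)) x = Star.star (Traw k x) := by
      unfold Traw; split_ifs <;> simp
    have hn := norm_ne_zero_iff.2 (Traw_ne_zero a.ne x)
    rw [this, norm_star, smul_mul_smul_comm, Quaternion.star_mul_self, Quaternion.normSq_eq_norm_mul_self]
    rw [Quaternion.smul_coe]
    field_simp
    rfl
  rw [this, map_inv]
  exact N.inv_mem h

theorem Good.list_prod {ι : Type*} (l : List ι) (k : ι → E3 → Quaternion ℝ) (h : ∀ i ∈ l, Good N (k i)) :
    Good N fun v => (l.map fun i => k i v).prod := by
  induction l with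
  | nil => simpa using good_one
  | cons a l ih =>
    simp only [List.map_cons, List.prod_cons]
    exact (h a (by simp)).mul (ih fun i hi => h i (by simp [hi]))

/-- The inverse of the chart. -/
noncomputable def cayRaw (v : E3) : Quaternion ℝ :=
  qt ((1 - ∑ i, v i ^ 2) / (1 + ∑ i, v i ^ 2)) ((2 / (1 + ∑ i, v i ^ 2)) • v)

theorem cay_norm (v : E3) : cayRaw v ∈ Metric.sphere (0 : Quaternion ℝ) 1 := by
  have h : 0 < 1 + ∑ i, v i ^ 2 := by positivity
  rw [mem_sphere_zero_iff_norm, ← sq_eq_sq₀ (norm_nonneg _) zero_le_one, sq, ← Quaternion.normSq_eq_norm_mul_self,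
    Quaternion.normSq_def']
  simp only [cayRaw, qt, Pi.smul_apply, smul_eq_mul]
  field_simp
  simp only [Fin.sum_univ_three]
  ring

noncomputable def cay (v : E3) : S3 := ⟨cayRaw v, cay_norm v⟩

theorem continuous_cay : Continuous cay := by
  refine Continuous.subtype_mk ?_ _
  have h : ∀ v : E3, 1 + ∑ i, v i ^ 2 ≠ 0 := fun v => by positivity
  refine continuous_qt (Continuous.div (by fun_prop) (by fun_prop) h) (Continuous.fun_smul ?_ continuous_id')
  exact Continuous.div (by fun_prop) (by fun_prop) h

theorem cay_chart (x : S3) (hx : (x : Quaternion ℝ).re ≠ -1) : cay (chart x) = x := by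
  apply Subtype.ext
  have h1 : 1 + (x : Quaternion ℝ).re ≠ 0 := fun h => hx (by linarith)
  have hs : 1 + ∑ i, chart x i ^ 2 = 2 / (1 + (x : Quaternion ℝ).re) := by
    simp only [Fin.sum_univ_three, chart, Matrix.cons_val]
    field_simp
    linarith [S3_sq x]
  have hs' : 1 - ∑ i, chart x i ^ 2 = 2 - 2 / (1 + (x : Quaternion ℝ).re) := by linarith
  simp only [cay, cayRaw, hs, hs']
  ext <;> simp [qt, chart] <;> field_simp
  ring

/-- Maps that are `1` on the back cap come from the chart. -/
theorem cls_mem_of_good (f : C(S3, S3)) (hf : ∀ x : S3, (x : Quaternion ℝ).re ≤ -1 / 2 → f x = 1)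
    (h : Good N fun v => (f (cay v) : Quaternion ℝ)) : cls f ∈ N := by
  obtain ⟨a, h⟩ := h
  have : T _ a = f := by
    ext1 x
    refine nrm_eq_of_pos _ _ x 1 one_pos _ ?_
    simp only [ContinuousMap.coe_mk, Traw, one_smul]
    split_ifs with hx
    · rw [hf x (by rw [hx]; norm_num)]; rfl
    · rw [cay_chart x hx]
  rwa [this] at h

theorem cay_re_le (v : E3) (hv : 2 < ‖v‖) : (cay v : Quaternion ℝ).re ≤ -1 / 2 := by
  have h : 0 < 1 + ∑ i, v i ^ 2 := by positivity
  have h4 : 4 < ∑ i, v i ^ 2 := by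
    by_contra hcon
    push Not at hcon
    refine absurd hv (not_lt.2 ((pi_norm_le_iff_of_nonneg (by norm_num)).2 fun i => ?_))
    have : v i ^ 2 ≤ ∑ i, v i ^ 2 := Finset.single_le_sum (f := fun i => v i ^ 2) (fun i _ => sq_nonneg _) (Finset.mem_univ i)
    exact abs_le_of_sq_le_sq (by linarith) (by norm_num)
  change (1 - ∑ i, v i ^ 2) / (1 + ∑ i, v i ^ 2) ≤ _
  rw [div_le_iff₀ h]
  linarith

end

section

variable {N : Subgroup (Coh S3)}

instance : PathConnectedSpace S3 := by
  rw [← isPathConnected_iff_pathConnectedSpace]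
  refine isPathConnected_sphere ?_ _ zero_le_one
  rw [← Module.finrank_eq_rank, Quaternion.finrank_eq_four]
  norm_num

theorem const_homotopic_one {X : Type*} [TopologicalSpace X] (b : S3) :
    (ContinuousMap.const X b).Homotopic 1 :=
  homotopic_of (fun y => PathConnectedSpace.somePath b 1 y.1) (by fun_prop) (by simp) (by simp)

theorem cls_const {X : Type*} [TopologicalSpace X] (b : S3) : cls (ContinuousMap.const X b) = 1 := by
  rw [← map_one cls]
  exact cls_eq_iff.2 (const_homotopic_one b)

noncomputable def bump (z : E3) (ρ : ℝ) (v : E3) : ℝ := max 0 (1 - ‖v - z‖ / ρ)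

theorem bump_self (z : E3) (ρ : ℝ) : bump z ρ z = 1 := by simp [bump]

theorem bump_nonneg (z : E3) (ρ : ℝ) (v : E3) : 0 ≤ bump z ρ v := le_max_left _ _

theorem bump_eq_zero {z : E3} {ρ : ℝ} {v : E3} (hρ : 0 < ρ) (h : ρ ≤ ‖v - z‖) : bump z ρ v = 0 := by
  apply max_eq_left
  have := (one_le_div hρ).2 h
  linarith

theorem bump_pos {z : E3} {ρ : ℝ} {v : E3} (hρ : 0 < ρ) (h : ‖v - z‖ < ρ) : 0 < bump z ρ v := by
  apply lt_max_of_lt_right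
  have := (div_lt_one hρ).2 h
  linarith

theorem continuous_bump (z : E3) (ρ : ℝ) : Continuous (bump z ρ) := by
  unfold bump; fun_prop

theorem qt_line (t a b : ℝ) (v w : E3) : (1 - t) • qt a v + t • qt b w =
    qt ((1 - t) * a + t * b) ((1 - t) • v + t • w) := by
  ext <;> simp

theorem star_qt (a : ℝ) (v : E3) : star (qt a v) = qt a (-v) := by
  ext <;> simp

theorem good_std (hN : cls (ContinuousMap.id S3) ∈ N) :
    Good N fun v => qt (1 - 2 * bump 0 1 v) (bump 0 1 v • v) := by
  have h : Adm fun v => qt (1 - 2 * bump 0 1 v) (bump 0 1 v • v) := by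
    refine ⟨continuous_qt (by have := continuous_bump 0 1; fun_prop) (by have := continuous_bump 0 1; fun_prop), ?_, 1, ?_⟩
    · intro v
      refine qt_ne_zero fun h0 h1 => ?_
      have hb : bump 0 1 v = 1 / 2 := by linarith
      rw [hb] at h1
      have : v = 0 := by simpa using h1
      rw [this, bump_self] at hb
      norm_num at hb
    · intro v hv
      rw [bump_eq_zero one_pos (by simpa using hv.le)]
      simpa using qt_one_zero
  refine ⟨h, ?_⟩
  let g : C(S3, Quaternion ℝ) := ⟨fun x => - star (x : Quaternion ℝ), by fun_prop⟩
  have hg : ∀ x, g x ≠ 0 := fun x => neg_ne_zero.2 (star_ne_zero.2 (S3_ne x))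
  have h2 : nrm g hg = ContinuousMap.const S3 (-1) * (ContinuousMap.id S3)⁻¹ := by
    ext1 x
    refine nrm_eq_of_pos _ _ x 1 one_pos _ ?_
    rw [one_smul]
    change -star (x : Quaternion ℝ) = (-1 : S3) * (x⁻¹ : S3)
    rw [show ((-1 : S3) : Quaternion ℝ) = -1 from rfl, Metric.unitSphere.coe_inv, neg_one_mul]
    rw [Quaternion.inv_def, Quaternion.normSq_eq_norm_mul_self, S3_norm]
    simp
  have h3 : cls (T _ h) = cls (nrm g hg) := by
    rw [cls_eq_iff]
    refine nrm_homotopic_line _ _ _ _ fun x t h0 h1 => ?_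
    simp only [ContinuousMap.coe_mk, Traw, g]
    split_ifs with hx
    · intro e
      have := congrArg QuaternionAlgebra.re e
      simp [hx] at this
    · intro e
      have e0 := congrArg QuaternionAlgebra.re e
      have e1 := congrArg QuaternionAlgebra.imI e
      have e2 := congrArg QuaternionAlgebra.imJ e
      have e3 := congrArg QuaternionAlgebra.imK e
      have hsq := S3_sq x
      have hpos : 0 < 1 + (x : Quaternion ℝ).re := by
        have : -1 ≤ (x : Quaternion ℝ).re := by nlinarith [sq_nonneg (x : Quaternion ℝ).imI, sq_nonneg (x : Quaternion ℝ).imJ, sq_nonneg (x : Quaternion ℝ).imK]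
        rcases eq_or_lt_of_le this with h | h
        · exact absurd h.symm hx
        · linarith
      set β := bump 0 1 (chart x) with hβ
      have hβ0 : 0 ≤ β := bump_nonneg _ _ _
      simp [chart] at e0 e1 e2 e3
      set c := (1 - t) * (β / (1 + (x : Quaternion ℝ).re)) + t with hc
      have e1' : c * (x : Quaternion ℝ).imI = 0 := by linear_combination e1 + (x : Quaternion ℝ).imI * hc
      have e2' : c * (x : Quaternion ℝ).imJ = 0 := by linear_combination e2 + (x : Quaternion ℝ).imJ * hc
      have e3' : c * (x : Quaternion ℝ).imK = 0 := by linear_combination e3 + (x : Quaternion ℝ).imK * hc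
      by_cases hcz : c = 0
      · have hA : 0 ≤ (1 - t) * (β / (1 + (x : Quaternion ℝ).re)) := mul_nonneg (by linarith) (by positivity)
        have ht : t = 0 := by linarith
        rw [ht] at hc e0
        have hb : β / (1 + (x : Quaternion ℝ).re) = 0 := by rw [hcz] at hc; linarith
        have hb' : β = 0 := by
          rcases div_eq_zero_iff.1 hb with h | h
          · exact h
          · exact absurd h hpos.ne'
        rw [hb'] at e0
        norm_num at e0
      · have i1 := (mul_eq_zero.1 e1').resolve_left hcz
        have i2 := (mul_eq_zero.1 e2').resolve_left hcz
        have i3 := (mul_eq_zero.1 e3').resolve_left hcz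
        have hch : chart x = 0 := by
          ext i; fin_cases i <;> simp [chart, i1, i2, i3]
        have hβ1 : β = 1 := by rw [hβ, hch, bump_self]
        have hre : (x : Quaternion ℝ).re = 1 := by
          rw [i1, i2, i3] at hsq
          have : ((x : Quaternion ℝ).re - 1) * (1 + (x : Quaternion ℝ).re) = 0 := by linarith
          rcases mul_eq_zero.1 this with h | h <;> linarith
        rw [hβ1, hre] at e0
        linarith
  rw [h3, h2, map_mul, cls_const, one_mul, map_inv]
  exact N.inv_mem hN

theorem good_matrix (hN : cls (ContinuousMap.id S3) ∈ N) (M : Matrix (Fin 3) (Fin 3) ℝ) (hM : M.det ≠ 0) :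
    Good N fun v => qt (1 - 2 * bump 0 1 v) (bump 0 1 v • M.mulVec v) := by
  obtain ⟨γ, h1, h2, h3, h4⟩ := joinedSign_of_det_ne_zero M hM
  have hb := continuous_bump 0 1
  have := good_of_homotopy (N := N) (fun t v => qt (1 - 2 * bump 0 1 v) (bump 0 1 v • (γ t).mulVec v)) ?_ ?_ ?_ ?_
  · simpa only [h3] using this
  · have hb' : Continuous fun y : ℝ × E3 => bump 0 1 y.2 := hb.comp continuous_snd
    refine continuous_qt (by fun_prop) (hb'.fun_smul ?_)
    exact (h1.comp continuous_fst).matrix_mulVec continuous_snd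
  · intro t t0 t1 v
    refine qt_ne_zero fun e0 e1 => ?_
    have hb : bump 0 1 v = 1 / 2 := by linarith
    rw [hb] at e1
    have e2 : (γ t).mulVec v = 0 := by simpa using e1
    have : v = 0 := Matrix.eq_zero_of_mulVec_eq_zero (h2 t t0 t1) e2
    rw [this, bump_self] at hb
    norm_num at hb
  · refine ⟨1, fun t _ _ v hv => ?_⟩
    rw [bump_eq_zero one_pos (by simpa using hv.le)]
    simpa using qt_one_zero
  · rcases h4 with h4 | h4
    · simpa [h4] using good_std hN
    · have := (good_std hN).star
      simpa [h4, star_qt, Matrix.neg_mulVec] using this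

theorem good_translate (hN : cls (ContinuousMap.id S3) ∈ N) (M : Matrix (Fin 3) (Fin 3) ℝ) (hM : M.det ≠ 0)
    (z : E3) (ρ : ℝ) (hρ : 0 < ρ) :
    Good N fun v => qt (1 - 2 * bump z ρ v) (bump z ρ v • M.mulVec (v - z)) := by
  let r : ℝ → ℝ := fun t => max (min ρ 1) ((1 - t) * ρ + t)
  have hr : Continuous r := by fun_prop
  have hr0 : ∀ t, 0 < r t := fun t => lt_max_of_lt_left (lt_min hρ one_pos)
  have hr0' : r 0 = ρ := by simp [r]
  have hr1 : r 1 = 1 := by simp [r]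
  have hbc : Continuous fun y : ℝ × E3 => bump ((1 - y.1) • z) (r y.1) y.2 := by
    unfold bump
    refine continuous_const.max (continuous_const.sub (Continuous.div (by fun_prop) (by fun_prop) fun y => (hr0 _).ne'))
  have := good_of_homotopy (N := N) (fun t v => qt (1 - 2 * bump ((1 - t) • z) (r t) v)
    (bump ((1 - t) • z) (r t) v • M.mulVec (v - (1 - t) • z))) ?_ ?_ ?_ ?_
  · simpa [hr0'] using this
  · refine continuous_qt (by fun_prop) (hbc.fun_smul ?_)
    exact continuous_const.matrix_mulVec (by fun_prop)
  · intro t t0 t1 v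
    refine qt_ne_zero fun e0 e1 => ?_
    have hb : bump ((1 - t) • z) (r t) v = 1 / 2 := by linarith
    rw [hb] at e1
    have e2 : M.mulVec (v - (1 - t) • z) = 0 := by simpa using e1
    have : v - (1 - t) • z = 0 := Matrix.eq_zero_of_mulVec_eq_zero hM e2
    rw [sub_eq_zero.1 this, bump_self] at hb
    norm_num at hb
  · refine ⟨‖z‖ + (ρ + 1), fun t t0 t1 v hv => ?_⟩
    have h1 : r t ≤ ρ + 1 := max_le ((min_le_left _ _).trans (by linarith)) (by nlinarith)
    have h2 : ‖(1 - t) • z‖ ≤ ‖z‖ := by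
      rw [norm_smul, Real.norm_of_nonneg (by linarith)]
      nlinarith [norm_nonneg z]
    have h3 := norm_sub_norm_le v ((1 - t) • z)
    rw [bump_eq_zero (hr0 t) (by linarith)]
    simpa using qt_one_zero
  · simpa [hr1] using good_matrix hN M hM

theorem good_local (hN : cls (ContinuousMap.id S3) ∈ N) (M : Matrix (Fin 3) (Fin 3) ℝ) (hM : M.det ≠ 0)
    (z : E3) (ρ : ℝ) (hρ : 0 < ρ) (q : E3 → E3) (hq : Continuous q)
    (h : ∀ v, ‖v - z‖ < ρ → v ≠ z → ‖q v - M.mulVec (v - z)‖ < ‖M.mulVec (v - z)‖) :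
    Good N fun v => qt (1 - 2 * bump z ρ v) (bump z ρ v • q v) := by
  have hbc := continuous_bump z ρ
  refine good_of_line (good_translate hN M hM z ρ hρ) (continuous_qt (by fun_prop) (by fun_prop)) ?_ ?_
  · refine ⟨‖z‖ + ρ, fun v hv => ?_⟩
    have h3 := norm_sub_norm_le v z
    rw [bump_eq_zero hρ (by linarith)]
    simpa using qt_one_zero
  · intro t t0 t1 v
    rw [qt_line]
    refine qt_ne_zero fun e0 e1 => ?_
    have hb : bump z ρ v = 1 / 2 := by linarith
    have hv : ‖v - z‖ < ρ := by
      by_contra hcon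
      rw [bump_eq_zero hρ (not_lt.1 hcon)] at hb
      norm_num at hb
    have hvz : v ≠ z := by
      rintro rfl
      rw [bump_self] at hb
      norm_num at hb
    rw [hb] at e1
    have := line_ne_zero_of_lt (a := M.mulVec (v - z)) (b := q v) (t := 1 - t)
      (by rw [norm_sub_rev]; exact h v hv hvz) (by linarith) (by linarith)
    apply this
    have e2 : (2 : ℝ) • ((1 - t) • (1 / 2 : ℝ) • q v + t • (1 / 2 : ℝ) • M.mulVec (v - z)) = 0 := by
      rw [e1, smul_zero]
    rw [← e2]
    module

end

section

variable {N : Subgroup (Coh S3)}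

theorem eventually_norm_sub_lt_of_hasFDerivAt {E : Type*} [NormedAddCommGroup E] [NormedSpace ℝ E]
    [FiniteDimensional ℝ E] {f : E → E} {L : E →L[ℝ] E} {z : E} (hf : HasFDerivAt f L z) (hz : f z = 0)
    (hL : L.det ≠ 0) : ∀ᶠ v in 𝓝 z, v ≠ z → ‖f v - L (v - z)‖ < ‖L (v - z)‖ := by
  let e := L.toContinuousLinearEquivOfDetNeZero hL
  have he : ∀ x, e x = L x := fun x => rfl
  have h1 := hf.isLittleO.trans_isBigO (e.isBigO_sub_rev (𝓝 z) z)
  filter_upwards [h1.def (c := 1 / 2) (by norm_num)] with v hv hne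
  rw [hz, sub_zero, he] at hv
  have : 0 < ‖L (v - z)‖ := by
    rw [norm_pos_iff, ← he]
    simpa [sub_eq_zero] using hne
  linarith

theorem exists_regular_approx (b : E3 → E3) (hb : Continuous b) {δ : ℝ} (hδ : 0 < δ) :
    ∃ q : E3 → E3, Differentiable ℝ q ∧ (∀ v, ‖q v - b v‖ < δ) ∧ ∀ v, q v = 0 → (fderiv ℝ q v).det ≠ 0 := by
  obtain ⟨g, hg, hgb, -⟩ := hb.exists_contDiff_approx 1 (continuous_const (y := δ / 2)) fun _ => half_pos hδ
  have hgd : Differentiable ℝ g := hg.differentiable (by simp)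
  have h0 := MeasureTheory.addHaar_image_eq_zero_of_det_fderivWithin_eq_zero MeasureTheory.volume
    (s := {v | (fderiv ℝ g v).det = 0}) (f := g) (f' := fderiv ℝ g)
    (fun x _ => (hgd x).hasFDerivAt.hasFDerivWithinAt) (fun x hx => hx)
  obtain ⟨w, hw, hwn⟩ : ∃ w ∈ Metric.ball (0 : E3) (δ / 2), w ∉ g '' {v | (fderiv ℝ g v).det = 0} := by
    by_contra! hcon
    have := MeasureTheory.measure_mono_null (μ := MeasureTheory.volume) (fun w hw => hcon w hw) h0
    exact (Metric.measure_ball_pos MeasureTheory.volume (0 : E3) (half_pos hδ)).ne' this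
  refine ⟨fun v => g v - w, hgd.sub_const w, fun v => ?_, fun v hv hd => ?_⟩
  · have h1 := hgb v
    rw [dist_eq_norm] at h1
    rw [mem_ball_zero_iff] at hw
    have : g v - w - b v = (g v - b v) - w := by abel
    rw [this]
    exact (norm_sub_le _ _).trans_lt (by linarith)
  · rw [fderiv_sub_const] at hd
    exact hwn ⟨v, hd, sub_eq_zero.1 hv⟩

theorem good_of_unit (hN : cls (ContinuousMap.id S3) ∈ N) (a : E3 → ℝ) (b : E3 → E3) (ha : Continuous a)
    (hb : Continuous b) (hab : ∀ v, a v ^ 2 + ∑ i, b v i ^ 2 = 1)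
    (hR : ∃ R : ℝ, ∀ v, R < ‖v‖ → a v = 1 ∧ b v = 0) : Good N fun v => qt (a v) (b v) := by
  obtain ⟨R, hR⟩ := hR
  obtain ⟨q, hqd, hqb, hqr⟩ := exists_regular_approx b hb (δ := 1 / 8) (by norm_num)
  have hq := hqd.continuous
  let l : E3 → ℝ := fun v => max 0 (min 1 (1 - 2 * a v))
  have hl : Continuous l := by fun_prop
  have hl0 : ∀ v, 0 ≤ l v := fun v => le_max_left _ _
  have hl1 : ∀ v, l v ≤ 1 := fun v => max_le zero_le_one (min_le_left _ _)
  let m : E3 → E3 := fun v => b v + l v • (q v - b v)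
  have hm : Continuous m := by fun_prop
  have hmq : ∀ v, a v ≤ 0 → m v = q v := by
    intro v hv
    have : l v = 1 := by
      simp only [l]
      rw [min_eq_left (by linarith)]; simp
    simp [m, this]
  have hmR : ∀ v, R < ‖v‖ → m v = 0 := by
    intro v hv
    have : l v = 0 := by
      simp only [l, (hR v hv).1]
      norm_num
    simp [m, this, hR v hv]
  have hbig : ∀ v, a v = 0 → 1 / 2 ≤ ‖b v‖ := by
    intro v hv
    by_contra! hcon
    have h1 := hab v
    have h2 : ∀ i, b v i ^ 2 ≤ 1 / 4 := fun i => by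
      have h3 := (norm_le_pi_norm (b v) i).trans hcon.le
      rw [Real.norm_eq_abs] at h3
      nlinarith [abs_nonneg (b v i), sq_abs (b v i)]
    have h3 := Finset.sum_le_sum (s := Finset.univ) fun i _ => h2 i
    simp only [Finset.sum_const, Finset.card_univ, Fintype.card_fin] at h3
    rw [hv] at h1
    norm_num at h3
    linarith
  have hmb : ∀ v, ‖b v - m v‖ ≤ 1 / 8 := by
    intro v
    have : b v - m v = -(l v • (q v - b v)) := by simp only [m]; abel
    rw [this, norm_neg, norm_smul, Real.norm_of_nonneg (hl0 v)]
    nlinarith [hqb v, hl0 v, hl1 v, norm_nonneg (q v - b v)]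
  have hqne : ∀ v, a v = 0 → q v ≠ 0 := by
    intro v hv e
    have := hmb v
    rw [hmq v hv.le, e, sub_zero] at this
    linarith [hbig v hv]
  suffices h1 : Good N fun v => qt (a v) (m v) by
    refine good_of_line h1 (continuous_qt ha hb) ⟨R, fun v hv => ?_⟩ ?_
    · rw [(hR v hv).1, (hR v hv).2, qt_one_zero]
    · intro t t0 t1 v
      rw [qt_line]
      refine qt_ne_zero fun e0 => line_ne_zero_of_lt ?_ t0 t1
      have e0' : a v = 0 := by linarith
      linarith [hmb v, hbig v e0']
  set Z : Set E3 := {v | q v = 0 ∧ a v ≤ 0} with hZ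
  have hZne : ∀ z ∈ Z, a z < 0 := fun z hz => lt_of_le_of_ne hz.2 fun e => hqne z e hz.1
  have hZc : IsCompact Z := by
    refine (isCompact_closedBall (0 : E3) R).of_isClosed_subset
      ((isClosed_eq hq continuous_const).inter (isClosed_le ha continuous_const)) fun v hv => ?_
    rw [mem_closedBall_zero_iff]
    by_contra! hcon
    have := hv.2
    rw [(hR v hcon).1] at this
    norm_num at this
  have hloc : ∀ z ∈ Z, ∀ᶠ v in 𝓝 z, a v < 0 ∧ (v ≠ z → ‖q v - fderiv ℝ q z (v - z)‖ < ‖fderiv ℝ q z (v - z)‖) := by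
    intro z hz
    exact (ha.continuousAt.eventually_lt_const (hZne z hz)).and
      (eventually_norm_sub_lt_of_hasFDerivAt (hqd z).hasFDerivAt hz.1 (hqr z hz.1))
  have hZf : Z.Finite := by
    refine hZc.finite (isDiscrete_iff_forall_mem_exists_isOpen.2 fun z hz => ?_)
    obtain ⟨u, hu, huo, hzu⟩ := eventually_nhds_iff.1 (hloc z hz)
    refine ⟨u, huo, Set.eq_singleton_iff_unique_mem.2 ⟨⟨hzu, hz⟩, fun v hv => ?_⟩⟩
    by_contra hne
    have := (hu v hv.1).2 hne
    rw [hv.2.1, zero_sub, norm_neg] at this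
    exact lt_irrefl _ this
  obtain ⟨ρ, hρ, hball⟩ : ∃ ρ > 0, ∀ z ∈ Z, ∀ v, ‖v - z‖ < ρ →
      a v < 0 ∧ (v ≠ z → ‖q v - fderiv ℝ q z (v - z)‖ < ‖fderiv ℝ q z (v - z)‖) := by
    have : ∀ᶠ ρ : ℝ in 𝓝[>] 0, ∀ z ∈ Z, ∀ v, ‖v - z‖ < ρ →
        a v < 0 ∧ (v ≠ z → ‖q v - fderiv ℝ q z (v - z)‖ < ‖fderiv ℝ q z (v - z)‖) := by
      refine (Filter.eventually_all_finite hZf).2 fun z hz => ?_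
      obtain ⟨ε, hε, h⟩ := Metric.eventually_nhds_iff.1 (hloc z hz)
      filter_upwards [Ioo_mem_nhdsGT hε] with ρ hρ v hv
      exact h (by rw [dist_eq_norm]; exact hv.trans hρ.2)
    obtain ⟨ρ, h1, h2⟩ := (this.and self_mem_nhdsWithin).exists
    exact ⟨ρ, h2, h1⟩
  have huniq : ∀ z ∈ Z, ∀ v, ‖v - z‖ < ρ → q v = 0 → v = z := by
    intro z hz v hv e
    by_contra hne
    have := (hball z hz v hv).2 hne
    rw [e, zero_sub, norm_neg] at this
    exact lt_irrefl _ this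
  have hρ2 := half_pos hρ
  let k : E3 → E3 → Quaternion ℝ := fun z v => qt (1 - 2 * bump z (ρ / 2) v) (bump z (ρ / 2) v • q v)
  have hkout : ∀ z v, ρ / 2 ≤ ‖v - z‖ → k z v = 1 := by
    intro z v h
    simp only [k]
    rw [bump_eq_zero hρ2 h]
    simpa using qt_one_zero
  have hk : Good N fun v => (hZf.toFinset.toList.map fun z => k z v).prod := by
    refine Good.list_prod _ _ fun z hz => ?_
    have hzZ : z ∈ Z := by simpa using hz
    refine good_local hN (LinearMap.toMatrix' (fderiv ℝ q z : E3 →ₗ[ℝ] E3)) ?_ z (ρ / 2) hρ2 q hq fun v hv hne => ?_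
    · rw [LinearMap.det_toMatrix']
      exact hqr z hzZ.1
    · rw [LinearMap.toMatrix'_mulVec]
      exact (hball z hzZ v (by linarith)).2 hne
  refine good_of_line hk (continuous_qt ha hm) ⟨R, fun v hv => ?_⟩ ?_
  · rw [(hR v hv).1, hmR v hv, qt_one_zero]
  intro t t0 t1 v
  by_cases hv : ∃ z ∈ Z, ‖v - z‖ < ρ / 2
  · obtain ⟨z, hz, hvz⟩ := hv
    have hprod : (hZf.toFinset.toList.map fun z => k z v).prod = k z v := by
      refine list_prod_eq_single _ (Finset.nodup_toList _) _ z (by simpa using hz) fun w hwl hw => ?_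
      have hwZ : w ∈ Z := by simpa using hwl
      refine hkout w v ?_
      by_contra! hcon
      refine hw (huniq z hz w ?_ hwZ.1)
      have : w - z = (v - z) - (v - w) := by abel
      rw [this]
      exact (norm_sub_le _ _).trans_lt (by linarith)
    rw [hprod]
    simp only [k]
    rw [qt_line, hmq v (hball z hz v (by linarith)).1.le]
    have hav := (hball z hz v (by linarith)).1
    have hβ := bump_pos hρ2 hvz
    refine qt_ne_zero fun e0 e1 => ?_
    have e2 : ((1 - t) + t * bump z (ρ / 2) v) • q v = 0 := by rw [← e1]; module
    rcases smul_eq_zero.1 e2 with h | h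
    · have : 0 ≤ t * bump z (ρ / 2) v := by positivity
      have ht : t = 1 := by linarith
      rw [ht] at h
      linarith
    · have := huniq z hz v (by linarith) h
      rw [this, bump_self] at e0
      rw [this] at hav
      have : t = 0 := by nlinarith
      rw [this] at e0
      linarith
  · push Not at hv
    have hprod : (hZf.toFinset.toList.map fun z => k z v).prod = 1 := by
      refine List.prod_eq_one fun x hx => ?_
      obtain ⟨z, hz, rfl⟩ := List.mem_map.1 hx
      exact hkout z v (hv z (by simpa using hz))
    rw [hprod, ← qt_one_zero, qt_line]
    refine qt_ne_zero fun e0 e1 => ?_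
    have ht : t < 1 := by
      rcases eq_or_lt_of_le t1 with h | h
      · rw [h] at e0; norm_num at e0
      · exact h
    have hm0 : m v = 0 := by
      have : (1 - t) • m v = 0 := by simpa using e1
      exact (smul_eq_zero.1 this).resolve_left (by linarith)
    have hav : a v ≤ 0 := by
      by_contra! hcon
      have := mul_pos (sub_pos.2 ht) hcon
      linarith
    rw [hmq v hav] at hm0
    have := hv v ⟨hm0, hav⟩
    rw [sub_self, norm_zero] at this
    linarith

end

section

theorem mul_left_homotopic_id (b : S3) : (ContinuousMap.const S3 b * ContinuousMap.id S3).Homotopic (ContinuousMap.id S3) := by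
  rw [← cls_eq_iff, map_mul, cls_const, one_mul]

theorem cls_comp_mul_left {b : S3} (f : C(S3, S3)) {e : C(S3, S3)} (he : ∀ x, e x = b * x) :
    cls (f.comp e) = cls f := by
  have : e = ContinuousMap.const S3 b * ContinuousMap.id S3 := ContinuousMap.ext he
  rw [this]
  nth_rewrite 2 [← ContinuousMap.comp_id f]
  exact cls_eq_iff.2 ((ContinuousMap.Homotopic.refl f).comp (mul_left_homotopic_id b))

variable {N : Subgroup (Coh S3)}

theorem cls_mem_of_eq_one (hN : cls (ContinuousMap.id S3) ∈ N) (f : C(S3, S3))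
    (hf : ∀ x : S3, (x : Quaternion ℝ).re ≤ -1 / 2 → f x = 1) : cls f ∈ N := by
  refine cls_mem_of_good f hf ?_
  have hc : Continuous fun v => (f (cay v) : Quaternion ℝ) :=
    continuous_subtype_val.comp (f.continuous.comp continuous_cay)
  have := good_of_unit hN (fun v => (f (cay v) : Quaternion ℝ).re)
    (fun v => ![(f (cay v) : Quaternion ℝ).imI, (f (cay v) : Quaternion ℝ).imJ, (f (cay v) : Quaternion ℝ).imK])
    (Quaternion.continuous_re.comp hc) ?_ ?_ ⟨2, fun v hv => ?_⟩
  · exact this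
  · refine continuous_pi fun i => ?_
    fin_cases i
    · exact Quaternion.continuous_imI.comp hc
    · exact Quaternion.continuous_imJ.comp hc
    · exact Quaternion.continuous_imK.comp hc
  · intro v
    have := S3_sq (f (cay v))
    simp [Fin.sum_univ_three]
    linarith
  · rw [hf _ (cay_re_le v hv)]
    constructor
    · simp
    · ext i; fin_cases i <;> simp

theorem cls_mem_of_id_mem (hN : cls (ContinuousMap.id S3) ∈ N) (f : C(S3, S3)) : cls f ∈ N := by
  have hre : Continuous fun x : S3 => (x : Quaternion ℝ).re := Quaternion.continuous_re.comp continuous_subtype_val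
  have hA1 : IsClosed {x : S3 | 0 ≤ (x : Quaternion ℝ).re} := isClosed_le continuous_const hre
  have hA2 : IsClosed {x : S3 | (x : Quaternion ℝ).re ≤ -1 / 2} := isClosed_le hre continuous_const
  classical
  obtain ⟨P, hP⟩ := extend_S3 (hA1.union hA2) (fun x => if 0 ≤ (x : Quaternion ℝ).re then f x else 1) (by
    refine ContinuousOn.union_of_isClosed ?_ ?_ hA1 hA2
    · exact f.continuous.continuousOn.congr fun x hx => if_pos hx
    · refine (continuousOn_const (c := 1)).congr fun x hx => if_neg ?_
      have := Set.mem_ofPred.1 hx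
      linarith)
  have h1 : cls P ∈ N := cls_mem_of_eq_one hN P fun x hx => by
    rw [hP (Or.inr hx)]
    exact if_neg (by linarith)
  let e : C(S3, S3) := ContinuousMap.const S3 (-1) * ContinuousMap.id S3
  have h2 : cls ((f * P⁻¹).comp e) ∈ N := by
    refine cls_mem_of_eq_one hN _ fun x hx => ?_
    have hex : 0 ≤ (e x : Quaternion ℝ).re := by
      change 0 ≤ ((-1 : Quaternion ℝ) * (x : Quaternion ℝ)).re
      simp
      linarith
    have : P (e x) = f (e x) := by
      rw [hP (Or.inl hex)]
      exact if_pos hex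
    simp [this]
  rw [cls_comp_mul_left (b := -1) _ (fun x => rfl), map_mul, map_inv] at h2
  have := N.mul_mem h2 h1
  rwa [inv_mul_cancel_right] at this

theorem exists_zpow_cls_id (c : Coh S3) : ∃ n : ℤ, c = cls (ContinuousMap.id S3) ^ n := by
  obtain ⟨f, rfl⟩ := cls_surj c
  obtain ⟨n, hn⟩ := cls_mem_of_id_mem (Subgroup.mem_zpowers (cls (ContinuousMap.id S3))) f
  exact ⟨n, hn.symm⟩

end

section

section degree

variable {n : ℕ}

noncomputable def volForm (n : ℕ) : (Fin n → ℝ) [⋀^Fin n]→L[ℝ] ℝ :=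
  { Matrix.detRowAlternating (R := ℝ) (n := Fin n) with
    cont := by
      change Continuous fun m : Fin n → Fin n → ℝ => Matrix.det (Matrix.of m)
      exact Continuous.matrix_det continuous_id }

theorem volForm_apply (v : Fin n → Fin n → ℝ) : volForm n v = Matrix.det (Matrix.of v) := rfl

theorem volForm_linear (L : (Fin n → ℝ) →L[ℝ] (Fin n → ℝ)) :
    volForm n (fun j => L (Pi.single j 1)) = L.det := by
  rw [volForm_apply, ← Matrix.det_transpose]
  change _ = LinearMap.det (L : (Fin n → ℝ) →ₗ[ℝ] (Fin n → ℝ))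
  rw [← LinearMap.det_toMatrix']
  congr 1

noncomputable def pullForm (φ : (Fin n → ℝ) → ℝ) (Φ : (Fin (n + 1) → ℝ) → Fin n → ℝ) (y : Fin (n + 1) → ℝ) :
    (Fin (n + 1) → ℝ) [⋀^Fin n]→L[ℝ] ℝ :=
  (φ (Φ y) • volForm n).compContinuousLinearMap (fderiv ℝ Φ y)

variable {φ : (Fin n → ℝ) → ℝ} {Φ : (Fin (n + 1) → ℝ) → Fin n → ℝ}

theorem pullForm_apply (y) (v : Fin n → Fin (n + 1) → ℝ) :
    pullForm φ Φ y v = φ (Φ y) * volForm n (fun j => fderiv ℝ Φ y (v j)) := rfl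

theorem differentiable_pullForm (hφ : ContDiff ℝ 1 φ) (hΦ : ContDiff ℝ 2 Φ) : Differentiable ℝ (pullForm φ Φ) := by
  intro y
  refine DifferentiableAt.continuousAlternatingMapCompContinuousLinearMap ?_ ?_
  · have : Differentiable ℝ fun y => φ (Φ y) := (hφ.differentiable (by simp)).comp (hΦ.differentiable (by simp))
    exact (this y).smul_const _
  · exact (hΦ.fderiv_right (m := 1) (by norm_num)).differentiable (by simp) y

theorem contDiff_pullForm_apply (hφ : ContDiff ℝ 1 φ) (hΦ : ContDiff ℝ 2 Φ) (v : Fin n → Fin (n + 1) → ℝ) :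
    ContDiff ℝ 1 fun y => pullForm φ Φ y v := by
  simp only [pullForm_apply]
  refine (hφ.comp (hΦ.of_le (by norm_num))).mul ?_
  refine ((volForm n).toContinuousMultilinearMap.contDiff).comp (contDiff_pi.2 fun j => ?_)
  exact (hΦ.fderiv_right (m := 1) (by norm_num)).clm_apply contDiff_const

theorem extDeriv_pullForm (hφ : ContDiff ℝ 1 φ) (hΦ : ContDiff ℝ 2 Φ) (y) : extDeriv (pullForm φ Φ) y = 0 := by
  have := extDeriv_pullback (𝕜 := ℝ) (ω := fun z => φ z • volForm n) (f := Φ) (x := y) (r := 2)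
    (((hφ.differentiable (by simp)) _).smul_const _) hΦ.contDiffAt (by simp)
  refine this.trans ?_
  ext v
  rw [ContinuousAlternatingMap.compContinuousLinearMap_apply]
  refine AlternatingMap.map_linearDependent (extDeriv (fun z => φ z • volForm n) (Φ y)).toAlternatingMap _ fun h => ?_
  have := h.fintype_card_le_finrank
  simp at this

theorem pullForm_cons (hΦ : ContDiff ℝ 2 Φ) (t : ℝ) (x : Fin n → ℝ) :
    pullForm φ Φ (Fin.cons t x) (fun j => Pi.single j.succ 1) =
      φ (Φ (Fin.cons t x)) * (fderiv ℝ (fun x => Φ (Fin.cons t x : Fin (n + 1) → ℝ)) x).det := by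
  rw [pullForm_apply, ← volForm_linear]
  congr 3
  ext1 j
  have h1 : HasFDerivAt (fun x : Fin n → ℝ => (Fin.cons t x : Fin (n + 1) → ℝ))
      ((0 : (Fin n → ℝ) →L[ℝ] ℝ).finCons (ContinuousLinearMap.id ℝ (Fin n → ℝ))) x :=
    HasFDerivAtFilter.finCons (hasFDerivAt_const t x) (hasFDerivAt_id x)
  have h2 := ((hΦ.differentiable (by simp)) (Fin.cons t x)).hasFDerivAt.comp x h1
  have h3 := h2.fderiv
  change fderiv ℝ (fun x => Φ (Fin.cons t x : Fin (n + 1) → ℝ)) x = _ at h3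
  rw [h3, ContinuousLinearMap.comp_apply]
  congr 1
  ext i
  refine Fin.cases ?_ (fun i => ?_) i
  · simp
  · simp [Pi.single_apply]

theorem integral_det_eq (hφ : ContDiff ℝ 1 φ) (hΦ : ContDiff ℝ 2 Φ)
    (h0 : ∀ t ∈ Set.Icc (0 : ℝ) 1, ∀ x ∈ Set.Icc (-1 : Fin n → ℝ) 1, (∃ i, x i = -1 ∨ x i = 1) →
      φ (Φ (Fin.cons t x)) = 0) :
    ∫ x in Set.Icc (-1 : Fin n → ℝ) 1, φ (Φ (Fin.cons 0 x)) * (fderiv ℝ (fun x => Φ (Fin.cons 0 x : Fin (n + 1) → ℝ)) x).det =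
    ∫ x in Set.Icc (-1 : Fin n → ℝ) 1, φ (Φ (Fin.cons 1 x)) * (fderiv ℝ (fun x => Φ (Fin.cons 1 x : Fin (n + 1) → ℝ)) x).det := by
  let a : Fin (n + 1) → ℝ := Fin.cons 0 (-1)
  let b : Fin (n + 1) → ℝ := Fin.cons 1 1
  have hab : a ≤ b := by
    refine Fin.cases ?_ fun i => ?_
    · simp [a, b]
    · simp [a, b]
  let e : Fin (n + 1) → Fin (n + 1) → ℝ := fun i => Pi.single i 1
  let f : Fin (n + 1) → (Fin (n + 1) → ℝ) → ℝ := fun i y => (-1) ^ i.val * pullForm φ Φ y (i.removeNth e)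
  have hf : ∀ i, ContDiff ℝ 1 (f i) := fun i => contDiff_const.mul (contDiff_pullForm_apply hφ hΦ _)
  have hdiv : ∀ y, ∑ i, fderiv ℝ (f i) y (Pi.single i 1) = 0 := by
    intro y
    have h1 := extDeriv_apply (differentiable_pullForm hφ hΦ y) e
    rw [extDeriv_pullForm hφ hΦ] at h1
    refine Eq.trans ?_ h1.symm
    refine Finset.sum_congr rfl fun i _ => ?_
    simp only [f]
    rw [fderiv_const_mul ((contDiff_pullForm_apply hφ hΦ _).differentiable (by simp) y)]
    rw [smul_apply, smul_eq_mul, zsmul_eq_mul]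
    simp [e]
  have key := MeasureTheory.integral_divergence_of_hasFDerivAt_off_countable' a b hab f (fun i y => fderiv ℝ (f i) y) ∅
    Set.countable_empty (fun i => (hf i).continuous.continuousOn)
    (fun x _ i => ((hf i).differentiable (by simp) x).hasFDerivAt) (by simp only [hdiv]; exact MeasureTheory.integrableOn_zero)
  simp only [hdiv, MeasureTheory.integral_zero] at key
  rw [Fin.sum_univ_succ, Finset.sum_eq_zero, add_zero] at key
  · have e0 : a ∘ Fin.succAbove 0 = -1 := by ext i; simp [a]
    have e1 : b ∘ Fin.succAbove 0 = 1 := by ext i; simp [b]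
    have e2 : ∀ y, f 0 y = pullForm φ Φ y (fun j => Pi.single j.succ 1) := by
      intro y
      simp only [f]
      simp
      rfl
    rw [e0, e1] at key
    simp only [e2, Fin.insertNth_zero', pullForm_cons hΦ, a, b, Fin.cons_zero] at key
    linarith
  · intro i _
    have hface : ∀ x ∈ Set.Icc (a ∘ Fin.succAbove i.succ) (b ∘ Fin.succAbove i.succ), ∀ s : ℝ, (s = -1 ∨ s = 1) →
        f i.succ (Fin.insertNth i.succ s x) = 0 := by
      intro x hx s hs
      simp only [f, pullForm_apply]
      have hy : (Fin.insertNth i.succ s x : Fin (n + 1) → ℝ) ∈ Set.Icc a b := by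
        rw [Fin.insertNth_mem_Icc]
        refine ⟨?_, hx⟩
        rcases hs with rfl | rfl <;> simp [a, b]
      set y := (Fin.insertNth i.succ s x : Fin (n + 1) → ℝ) with hydef
      have hyi : y i.succ = s := by simp [hydef]
      have h2 : y = Fin.cons (y 0) (fun j => y j.succ) := (Fin.cons_self_tail y).symm
      have := h0 (y 0) ⟨by simpa [a] using hy.1 0, by simpa [b] using hy.2 0⟩ (fun j => y j.succ)
        ⟨fun j => by simpa [a] using hy.1 j.succ, fun j => by simpa [b] using hy.2 j.succ⟩ ⟨i, by rw [hyi]; exact hs⟩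
      rw [← h2] at this
      rw [this]; simp
    have hms : MeasurableSet (Set.Icc (a ∘ Fin.succAbove i.succ) (b ∘ Fin.succAbove i.succ)) := measurableSet_Icc
    rw [MeasureTheory.setIntegral_eq_zero_of_forall_eq_zero, MeasureTheory.setIntegral_eq_zero_of_forall_eq_zero, sub_zero]
    · exact fun x hx => hface x hx _ (Or.inl (by simp [a]))
    · exact fun x hx => hface x hx _ (Or.inr (by simp [b]))

end degree

end

section

/-- The map `(z, w) ↦ (conj z ^ m, w)` of `ℍ = ℂ²`. -/
noncomputable def conjPow (m : ℕ) (x : Quaternion ℝ) : Quaternion ℝ :=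
  ⟨((starRingEnd ℂ ⟨x.re, x.imI⟩) ^ m).re, ((starRingEnd ℂ ⟨x.re, x.imI⟩) ^ m).im, x.imJ, x.imK⟩

theorem continuous_complex_mk {X : Type*} [TopologicalSpace X] {a b : X → ℝ} (ha : Continuous a) (hb : Continuous b) :
    Continuous fun x => (⟨a x, b x⟩ : ℂ) := by
  have : (fun x => (⟨a x, b x⟩ : ℂ)) = fun x => (a x : ℂ) + b x * Complex.I := by
    ext x; exact Complex.mk_eq_add_mul_I _ _
  rw [this]; fun_prop

theorem continuous_conjPow (m : ℕ) : Continuous (conjPow m) := by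
  have h : Continuous fun x : Quaternion ℝ => (starRingEnd ℂ ⟨x.re, x.imI⟩) ^ m :=
    (Complex.continuous_conj.comp (continuous_complex_mk Quaternion.continuous_re Quaternion.continuous_imI)).pow m
  exact continuous_of_components (Complex.continuous_re.comp h) (Complex.continuous_im.comp h)
    Quaternion.continuous_imJ Quaternion.continuous_imK

theorem conjPow_ne_zero (m : ℕ) {x : Quaternion ℝ} (hx : x ≠ 0) : conjPow m x ≠ 0 := by
  intro e
  have e0 : ((starRingEnd ℂ ⟨x.re, x.imI⟩) ^ m).re = 0 := congrArg QuaternionAlgebra.re e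
  have e1 : ((starRingEnd ℂ ⟨x.re, x.imI⟩) ^ m).im = 0 := congrArg QuaternionAlgebra.imI e
  have e2 : x.imJ = 0 := congrArg QuaternionAlgebra.imJ e
  have e3 : x.imK = 0 := congrArg QuaternionAlgebra.imK e
  have e4 : (starRingEnd ℂ ⟨x.re, x.imI⟩) ^ m = 0 := Complex.ext e0 e1
  have e5 : (⟨x.re, x.imI⟩ : ℂ) = 0 := by simpa using eq_zero_of_pow_eq_zero e4
  apply hx
  have e6 := congrArg Complex.re e5
  have e7 := congrArg Complex.im e5
  ext
  · exact e6
  · exact e7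
  · exact e2
  · exact e3

noncomputable def conjPowMap (m : ℕ) : C(S3, S3) :=
  nrm ⟨fun x => conjPow m x, (continuous_conjPow m).comp continuous_subtype_val⟩ fun x => conjPow_ne_zero m (S3_ne x)

abbrev V4 := Fin 4 → ℝ

def toQuat (v : V4) : Quaternion ℝ := ⟨v 0, v 1, v 2, v 3⟩

def ofQuat (x : Quaternion ℝ) : V4 := ![x.re, x.imI, x.imJ, x.imK]

theorem ofQuat_toQuat (v : V4) : ofQuat (toQuat v) = v := by
  ext i; fin_cases i <;> rfl

theorem toQuat_ofQuat (x : Quaternion ℝ) : toQuat (ofQuat x) = x := rfl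

theorem continuous_toQuat : Continuous toQuat :=
  continuous_of_components (by simp only [toQuat]; fun_prop) (by simp only [toQuat]; fun_prop)
    (by simp only [toQuat]; fun_prop) (by simp only [toQuat]; fun_prop)

theorem continuous_ofQuat : Continuous ofQuat := by
  refine continuous_pi fun i => ?_
  fin_cases i
  · exact Quaternion.continuous_re
  · exact Quaternion.continuous_imI
  · exact Quaternion.continuous_imJ
  · exact Quaternion.continuous_imK

theorem toQuat_ne_zero {v : V4} (h : v ≠ 0) : toQuat v ≠ 0 := by
  intro e
  apply h
  rw [← ofQuat_toQuat v, e]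
  ext i; fin_cases i <;> rfl

theorem ofQuat_ne_zero {x : Quaternion ℝ} (h : x ≠ 0) : ofQuat x ≠ 0 := by
  intro e
  apply h
  rw [← toQuat_ofQuat x, e]
  rfl

theorem hasFDerivAt_conjPow (m : ℕ) (v : V4) : ∃ L : V4 →L[ℝ] V4,
    HasFDerivAt (fun v => ofQuat (conjPow m (toQuat v))) L v ∧ L.det ≤ 0 := by
  let l : V4 →L[ℝ] ℂ := (Complex.conjCLE : ℂ →L[ℝ] ℂ) ∘L Complex.equivRealProdCLM.symm.toContinuousLinearMap ∘L
    (ContinuousLinearMap.proj 0).prod (ContinuousLinearMap.proj 1)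
  have hl : ∀ v, l v = starRingEnd ℂ ⟨v 0, v 1⟩ := by
    intro v
    rfl
  have h1 := (l.hasFDerivAt (x := v)).pow m
  set c : ℂ := m * l v ^ (m - 1) with hc
  let L : V4 →L[ℝ] V4 := ContinuousLinearMap.pi ![Complex.reCLM ∘L (c • l), Complex.imCLM ∘L (c • l),
    ContinuousLinearMap.proj 2, ContinuousLinearMap.proj 3]
  have h2 : HasFDerivAt (fun v => l v ^ m) (c • l) v := by
    have h3 : c = m • l v ^ (m - 1) := by rw [hc, nsmul_eq_mul]
    rw [h3]
    exact h1
  refine ⟨L, ?_, ?_⟩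
  · refine hasFDerivAt_pi.2 fun i => ?_
    fin_cases i
    · exact Complex.reCLM.hasFDerivAt.comp v h2
    · exact Complex.imCLM.hasFDerivAt.comp v h2
    · exact (ContinuousLinearMap.proj (R := ℝ) (φ := fun _ : Fin 4 => ℝ) 2).hasFDerivAt
    · exact (ContinuousLinearMap.proj (R := ℝ) (φ := fun _ : Fin 4 => ℝ) 3).hasFDerivAt
  · rw [← volForm_linear, volForm_apply]
    have : Matrix.det (Matrix.of fun j => L (Pi.single j 1)) = -(c.re ^ 2 + c.im ^ 2) := by
      rw [Matrix.det_succ_row_zero]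
      simp [Fin.sum_univ_succ, Matrix.det_fin_three, L, hl, Fin.succAbove]
      ring
    rw [this]
    nlinarith [sq_nonneg c.re, sq_nonneg c.im]

end

section

abbrev cube (n : ℕ) : Set (Fin n → ℝ) := Set.Icc (-1) 1

def cubeBdry (n : ℕ) : Set (Fin n → ℝ) := {x | x ∈ cube n ∧ ∃ i, x i = -1 ∨ x i = 1}

def cylBdry (n : ℕ) : Set (Fin (n + 1) → ℝ) := {y | y 0 ∈ Set.Icc (0 : ℝ) 1 ∧ Fin.tail y ∈ cubeBdry n}

variable {n : ℕ}

theorem continuous_tail : Continuous fun y : Fin (n + 1) → ℝ => (Fin.tail y : Fin n → ℝ) :=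
  continuous_pi fun i => continuous_apply i.succ

theorem isCompact_cubeBdry : IsCompact (cubeBdry n) := by
  refine (isCompact_Icc (a := (-1 : Fin n → ℝ)) (b := 1)).of_isClosed_subset ?_ fun x hx => hx.1
  have : cubeBdry n = cube n ∩ ⋃ i, {x | x i = -1 ∨ x i = 1} := by
    ext x; simp [cubeBdry]
  rw [this]
  refine isClosed_Icc.inter (isClosed_iUnion_of_finite fun i => ?_)
  exact (isClosed_eq (continuous_apply i) continuous_const).union (isClosed_eq (continuous_apply i) continuous_const)

theorem isClosed_cylBdry : IsClosed (cylBdry n) :=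
  (isClosed_Icc.preimage (continuous_apply 0)).inter (isCompact_cubeBdry.isClosed.preimage continuous_tail)

theorem isCompact_cylBdry : IsCompact (cylBdry n) := by
  refine (isCompact_Icc (a := (-1 : Fin (n + 1) → ℝ)) (b := 1)).of_isClosed_subset isClosed_cylBdry fun y hy => ?_
  constructor
  · refine fun i => Fin.cases ?_ (fun i => hy.2.1.1 i) i
    have := hy.1.1
    simp only [Pi.neg_apply, Pi.one_apply]; linarith
  · exact fun i => Fin.cases hy.1.2 (fun i => hy.2.1.2 i) i

theorem ne_zero_of_mem_cubeBdry {x : Fin n → ℝ} (hx : x ∈ cubeBdry n) : x ≠ 0 := by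
  rintro rfl
  obtain ⟨-, i, h | h⟩ := hx <;> simp at h

/-- The homotopy invariant: the integral of the pulled back volume form. -/
noncomputable def degInt (φ : (Fin n → ℝ) → ℝ) (f : (Fin n → ℝ) → Fin n → ℝ) : ℝ :=
  ∫ x in cube n, φ (f x) * (fderiv ℝ f x).det

theorem degInt_eq (Φ : (Fin (n + 1) → ℝ) → Fin n → ℝ) (hΦ : ContDiff ℝ 2 Φ) (h : ∀ y ∈ cylBdry n, Φ y ≠ 0)
    (f g : (Fin n → ℝ) → Fin n → ℝ) (hf : ∀ x, Φ (Fin.cons 0 x) = f x) (hg : ∀ x, Φ (Fin.cons 1 x) = g x) :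
    ∀ᶠ ε : ℝ in 𝓝[>] 0, ∀ φ, ContDiff ℝ 1 φ → (∀ v, ε ≤ ‖v‖ → φ v = 0) → degInt φ f = degInt φ g := by
  obtain ⟨ε, hε, hεle⟩ := isCompact_cylBdry.exists_forall_le' (f := fun y => ‖Φ y‖) (a := 0)
    hΦ.continuous.norm.continuousOn fun y hy => norm_pos_iff.2 (h y hy)
  filter_upwards [Ioo_mem_nhdsGT hε] with δ hδ φ hφ h0
  have := integral_det_eq hφ hΦ fun t ht x hx hxi => h0 _ (hδ.2.le.trans (hεle _ ⟨by simpa using ht, by simpa using ⟨hx, hxi⟩⟩))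
  simp only [hf, hg] at this
  exact this

theorem contDiff_tail {k : ℕ∞} : ContDiff ℝ k fun y : Fin (n + 1) → ℝ => (Fin.tail y : Fin n → ℝ) :=
  contDiff_pi.2 fun i => contDiff_apply ℝ ℝ i.succ

theorem contDiff_cons {k : ℕ∞} (t : ℝ) : ContDiff ℝ k fun y : Fin n → ℝ => (Fin.cons t y : Fin (n + 1) → ℝ) := by
  refine contDiff_pi.2 fun i => ?_
  refine Fin.cases ?_ (fun i => ?_) i
  · simpa using contDiff_const
  · simpa using contDiff_apply ℝ ℝ i

theorem degInt_eq_line (f g : (Fin n → ℝ) → Fin n → ℝ) (hf : ContDiff ℝ 2 f) (hg : ContDiff ℝ 2 g)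
    (h : ∀ x ∈ cubeBdry n, ‖f x - g x‖ < ‖f x‖) :
    ∀ᶠ ε : ℝ in 𝓝[>] 0, ∀ φ, ContDiff ℝ 1 φ → (∀ v, ε ≤ ‖v‖ → φ v = 0) → degInt φ f = degInt φ g := by
  refine degInt_eq (fun y => (1 - y 0) • f (Fin.tail y) + y 0 • g (Fin.tail y)) ?_ ?_ f g ?_ ?_
  · have h0 : ContDiff ℝ 2 fun y : Fin (n + 1) → ℝ => y 0 := contDiff_apply ℝ ℝ 0
    exact ((contDiff_const.sub h0).smul (hf.comp contDiff_tail)).add (h0.smul (hg.comp contDiff_tail))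
  · exact fun y hy => line_ne_zero_of_lt (h _ hy.2) hy.1.1 hy.1.2
  · simp
  · simp

/-- Continuous homotopies in the complement of `0` preserve the invariant. -/
theorem degInt_eq_of_homotopy (f g : (Fin n → ℝ) → Fin n → ℝ) (hf : ContDiff ℝ 2 f) (hg : ContDiff ℝ 2 g)
    (K : unitInterval × cubeBdry n → Fin n → ℝ) (hK : Continuous K) (hne : ∀ y, K y ≠ 0)
    (h0 : ∀ x, K (0, x) = f x) (h1 : ∀ x, K (1, x) = g x) :
    ∀ᶠ ε : ℝ in 𝓝[>] 0, ∀ φ, ContDiff ℝ 1 φ → (∀ v, ε ≤ ‖v‖ → φ v = 0) → degInt φ f = degInt φ g := by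
  let k : C(cylBdry n, Fin n → ℝ) :=
    ⟨fun y => K (⟨y.1 0, y.2.1⟩, ⟨Fin.tail y.1, y.2.2⟩), hK.comp
      ((((continuous_apply 0).comp continuous_subtype_val).subtype_mk _).prodMk
        ((continuous_tail.comp continuous_subtype_val).subtype_mk _))⟩
  obtain ⟨k', hk'⟩ := ContinuousMap.exists_restrict_eq isClosed_cylBdry k
  have hk : ∀ (t : unitInterval) (x : cubeBdry n), k' (Fin.cons (t : ℝ) (x : Fin n → ℝ)) = K (t, x) := by
    intro t x
    have := DFunLike.congr_fun hk' ⟨Fin.cons (t : ℝ) (x : Fin n → ℝ), by simp, by simp⟩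
    simpa [k] using this
  have hne' : ∀ y ∈ cylBdry n, k' y ≠ 0 := by
    intro y hy
    have := hk ⟨y 0, hy.1⟩ ⟨Fin.tail y, hy.2⟩
    rw [Fin.cons_self_tail] at this
    rw [this]
    exact hne _
  obtain ⟨ε, hε, hεle⟩ := isCompact_cylBdry.exists_forall_le' (f := fun y => ‖k' y‖) (a := 0)
    k'.continuous.norm.continuousOn fun y hy => norm_pos_iff.2 (hne' y hy)
  obtain ⟨P, hP, hPk, -⟩ := k'.continuous.exists_contDiff_approx 2 (continuous_const (y := ε)) fun _ => hε
  simp only [dist_eq_norm] at hPk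
  have e1 := degInt_eq_line f (fun x => P (Fin.cons 0 x)) hf (hP.comp (contDiff_cons 0)) (by
    intro x hx
    have := hk 0 ⟨x, hx⟩
    rw [h0] at this
    rw [Set.Icc.coe_zero] at this
    have hmem : (Fin.cons 0 x : Fin (n + 1) → ℝ) ∈ cylBdry n := ⟨by simp, by simpa using hx⟩
    rw [← this, norm_sub_rev]
    exact (hPk _).trans_le (hεle _ hmem))
  have e3 := degInt_eq_line g (fun x => P (Fin.cons 1 x)) hg (hP.comp (contDiff_cons 1)) (by
    intro x hx
    have := hk 1 ⟨x, hx⟩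
    rw [h1] at this
    rw [Set.Icc.coe_one] at this
    have hmem : (Fin.cons 1 x : Fin (n + 1) → ℝ) ∈ cylBdry n := ⟨by simp, by simpa using hx⟩
    rw [← this, norm_sub_rev]
    exact (hPk _).trans_le (hεle _ hmem))
  have e2 := degInt_eq P hP (fun y hy e => by
    have h1 := hPk y
    rw [e, zero_sub, norm_neg] at h1
    exact absurd (hεle y hy) (not_le.2 h1)) _ _ (fun _ => rfl) (fun _ => rfl)
  filter_upwards [e1, e2, e3] with δ h1 h2 h3 φ hφ hδ
  rw [h1 φ hφ hδ, h2 φ hφ hδ, h3 φ hφ hδ]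

theorem degInt_id_pos {φ : (Fin n → ℝ) → ℝ} (hφ : Continuous φ) (h0 : 0 < φ 0) (hnn : ∀ v, 0 ≤ φ v) : 0 < degInt φ id := by
  have : ∀ x, φ (id x) * (fderiv ℝ (id : (Fin n → ℝ) → Fin n → ℝ) x).det = φ x := by
    intro x
    rw [fderiv_id]
    change φ x * LinearMap.det (LinearMap.id : (Fin n → ℝ) →ₗ[ℝ] (Fin n → ℝ)) = φ x
    simp
  simp only [degInt, this]
  rw [MeasureTheory.setIntegral_pos_iff_support_of_nonneg_ae (Filter.Eventually.of_forall hnn)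
    (hφ.continuousOn.integrableOn_compact isCompact_Icc)]
  have : Function.support φ ∩ cube n ∈ 𝓝 (0 : Fin n → ℝ) := by
    refine Filter.inter_mem (hφ.isOpen_support.mem_nhds h0.ne') (pi_Icc_mem_nhds (fun i => ?_) fun i => ?_) <;> simp
  exact MeasureTheory.Measure.measure_pos_of_mem_nhds _ this

theorem degInt_nonpos {φ : (Fin n → ℝ) → ℝ} (hnn : ∀ v, 0 ≤ φ v) {f : (Fin n → ℝ) → Fin n → ℝ}
    (hf : ∀ x, (fderiv ℝ f x).det ≤ 0) : degInt φ f ≤ 0 :=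
  MeasureTheory.setIntegral_nonpos measurableSet_Icc fun x _ => mul_nonpos_of_nonneg_of_nonpos (hnn _) (hf x)

end

section

abbrev PuncturedQuat := {x : Quaternion ℝ // x ≠ 0}

theorem homotopic_of_pos_smul {X : Type*} [TopologicalSpace X] {f g : C(X, PuncturedQuat)}
    (h : ∀ x, ∃ r : ℝ, 0 < r ∧ (g x : Quaternion ℝ) = r • (f x : Quaternion ℝ)) : f.Homotopic g := by
  refine homotopic_of (fun y => ⟨(1 - (y.1 : ℝ)) • (f y.2 : Quaternion ℝ) + (y.1 : ℝ) • (g y.2 : Quaternion ℝ), ?_⟩)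
    ?_ ?_ ?_
  · obtain ⟨r, hr, e⟩ := h y.2
    rw [e, smul_smul, ← add_smul]
    refine smul_ne_zero (ne_of_gt ?_) (f y.2).2
    rcases y.1.2.1.eq_or_lt with h0 | h0
    · rw [← h0]; simp
    · have := mul_pos h0 hr
      linarith [y.1.2.2]
  · exact Continuous.subtype_mk (by fun_prop) _
  · intro x; apply Subtype.ext; simp
  · intro x; apply Subtype.ext; simp

theorem contDiff_conjPow (m : ℕ) {n : WithTop ℕ∞} : ContDiff ℝ n fun v => ofQuat (conjPow m (toQuat v)) := by
  let l : V4 →L[ℝ] ℂ := (Complex.conjCLE : ℂ →L[ℝ] ℂ) ∘L Complex.equivRealProdCLM.symm.toContinuousLinearMap ∘L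
    (ContinuousLinearMap.proj 0).prod (ContinuousLinearMap.proj 1)
  have h : ContDiff ℝ n fun v => l v ^ m := l.contDiff.pow m
  refine contDiff_pi.2 fun i => ?_
  fin_cases i
  · exact Complex.reCLM.contDiff.comp h
  · exact Complex.imCLM.contDiff.comp h
  · exact contDiff_apply ℝ ℝ (2 : Fin 4)
  · exact contDiff_apply ℝ ℝ (3 : Fin 4)

theorem not_conjPowMap_homotopic_id (m : ℕ) : ¬ (conjPowMap m).Homotopic (ContinuousMap.id S3) := by
  intro hom
  let j : C(cubeBdry 4, PuncturedQuat) := ⟨fun v => ⟨toQuat v, toQuat_ne_zero (ne_zero_of_mem_cubeBdry v.2)⟩,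
    (continuous_toQuat.comp continuous_subtype_val).subtype_mk _⟩
  let ρ : C(cubeBdry 4, S3) := nrm ⟨fun v => j v, continuous_subtype_val.comp j.continuous⟩ fun v => (j v).2
  let ι : C(S3, PuncturedQuat) := ⟨fun x => ⟨x, S3_ne x⟩, continuous_subtype_val.subtype_mk _⟩
  let γ : C(PuncturedQuat, PuncturedQuat) := ⟨fun x => ⟨conjPow m x, conjPow_ne_zero m x.2⟩,
    ((continuous_conjPow m).comp continuous_subtype_val).subtype_mk _⟩
  have h1 : j.Homotopic (ι.comp ρ) := homotopic_of_pos_smul fun v =>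
    ⟨_, inv_pos.2 (norm_pos_iff.2 (j v).2), rfl⟩
  have h2 : (γ.comp ι).Homotopic (ι.comp (conjPowMap m)) := homotopic_of_pos_smul fun x =>
    ⟨_, inv_pos.2 (norm_pos_iff.2 (conjPow_ne_zero m (S3_ne x))), rfl⟩
  have h3 : (γ.comp j).Homotopic j := by
    refine (((ContinuousMap.Homotopic.refl γ).comp h1).trans ?_).trans h1.symm
    exact (h2.trans ((ContinuousMap.Homotopic.refl ι).comp hom)).comp (ContinuousMap.Homotopic.refl ρ)
  obtain ⟨K⟩ := h3
  have h4 := degInt_eq_of_homotopy (n := 4) (fun v => ofQuat (conjPow m (toQuat v))) id (contDiff_conjPow m) contDiff_id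
    (fun y => ofQuat (K y)) (continuous_ofQuat.comp (continuous_subtype_val.comp K.continuous))
    (fun y => ofQuat_ne_zero (K y).2) (fun x => by rw [K.apply_zero]; rfl)
    (fun x => by rw [K.apply_one]; exact ofQuat_toQuat _)
  obtain ⟨ε, hε, (hε0 : 0 < ε)⟩ := (h4.and self_mem_nhdsWithin).exists
  let φ : ContDiffBump (0 : Fin 4 → ℝ) := ⟨ε / 2, ε, by positivity, by linarith⟩
  have h5 := hε φ φ.contDiff fun v hv => φ.zero_of_le_dist (by simpa using hv)
  have h6 := degInt_id_pos φ.continuous (φ.pos_of_mem_ball (by simpa using hε0)) fun v => φ.nonneg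
  have h7 := degInt_nonpos (φ := φ) (fun v => φ.nonneg) (f := fun v => ofQuat (conjPow m (toQuat v))) fun x => by
    obtain ⟨L, hL, hd⟩ := hasFDerivAt_conjPow m x
    rwa [hL.fderiv]
  linarith

end

section

/-- The class of the identity. -/
noncomputable def unitClass : Coh S3 := cls (ContinuousMap.id S3)

theorem exists_zpow_unitClass (f : C(S3, S3)) : ∃ n : ℤ, cls f = unitClass ^ n := exists_zpow_cls_id _

theorem pull_unitClass (e : C(S3, S3)) : pull e unitClass = cls e := by
  rw [unitClass, pull_cls, ContinuousMap.id_comp]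

noncomputable def rootOfUnity (z : ℂ) (hz : ‖z‖ = 1) : S3 := ⟨Quaternion.ofComplex z, by
  rw [mem_sphere_zero_iff_norm, ← sq_eq_sq₀ (norm_nonneg _) zero_le_one, pow_two, ← Quaternion.normSq_eq_norm_mul_self,
    Quaternion.normSq_def']
  have := Complex.normSq_eq_norm_sq z
  rw [hz, Complex.normSq_apply] at this
  simp
  linarith⟩

theorem rootOfUnity_pow (z : ℂ) (hz : ‖z‖ = 1) (k : ℕ) : rootOfUnity z hz ^ k = 1 ↔ z ^ k = 1 := by
  have h1 : rootOfUnity z hz ^ k = 1 ↔ (Quaternion.ofComplex z) ^ k = 1 := Subtype.ext_iff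
  rw [h1, ← map_pow, ← map_one Quaternion.ofComplex]
  exact (Quaternion.ofComplex : ℂ →+* Quaternion ℝ).injective.eq_iff

theorem orderOf_rootOfUnity {N : ℕ} {z : ℂ} (h : IsPrimitiveRoot z N) (hz : ‖z‖ = 1) :
    orderOf (rootOfUnity z hz) = N := by
  rw [h.eq_orderOf]
  exact orderOf_eq_orderOf_iff.2 (rootOfUnity_pow z hz)

variable {N : ℕ} [NeZero N] {w : S3}

theorem isFreeAct_pow_mul (hw : orderOf w = N) : IsFreeAct fun (g : ZMod N) (x : S3) => w ^ g.val * x where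
  cont g := by fun_prop
  zero x := by simp
  add g h x := by
    have pow_mod_eq : w ^ ((g.val + h.val) % N) = w ^ (g.val + h.val) := by simp only [← hw, pow_mod_orderOf]
    rw [← mul_assoc, ← pow_add, ZMod.val_add, pow_mod_eq]
  free g hg x e := by
    have h1 : w ^ g.val = 1 := by simpa using e
    rw [← orderOf_dvd_iff_pow_eq_one, hw] at h1
    exact hg ((ZMod.val_eq_zero g).1 (Nat.eq_zero_of_dvd_of_lt h1 g.val_lt))

theorem cls_mem_of_mul_left_invariant (hw : orderOf w = N) {D : C(S3, S3)} (hD : ∀ x, D (w * x) = D x) :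
    cls D ∈ Subgroup.zpowers (unitClass ^ N) := by
  have hD' : ∀ (k : ℕ) x, D (w ^ k * x) = D x := by
    intro k
    induction k with
    | zero => simp
    | succ k ih => intro x; rw [pow_succ, mul_assoc, ih, hD]
  refine cls_mem_of_invariant (isFreeAct_pow_mul hw) _ (fun q => ?_) D fun g x => hD' _ x
  obtain ⟨n, hn⟩ := exists_zpow_unitClass q
  have : ∀ g : ZMod N, cls (q.comp ⟨fun x => w ^ g.val * x, (isFreeAct_pow_mul hw).cont g⟩) = unitClass ^ n := by
    intro g
    rw [cls_comp_mul_left (b := w ^ g.val) q fun x => rfl, hn]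
  simp only [this, List.map_const', List.prod_replicate, Finset.length_toList, Finset.card_univ, ZMod.card]
  exact ⟨n, by dsimp only; rw [← zpow_natCast, ← zpow_natCast, ← zpow_mul, ← zpow_mul, mul_comm]⟩

theorem cls_mem_zpowers_of_equivariant (hw : orderOf w = N) {F : C(S3, S3)} (hF : ∀ x, F (w * x) = w * F x) :
    ∃ D ∈ Subgroup.zpowers (unitClass ^ N), cls F = unitClass * D := by
  refine ⟨cls ((ContinuousMap.id S3)⁻¹ * F), cls_mem_of_mul_left_invariant hw fun x => ?_, ?_⟩
  · change (w * x)⁻¹ * F (w * x) = x⁻¹ * F x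
    rw [hF, mul_inv_rev, mul_assoc, inv_mul_cancel_left]
  · rw [map_mul, map_inv, unitClass, mul_inv_cancel_left]

theorem conjPow_ofComplex_mul {m : ℕ} {z : ℂ} (hz : starRingEnd ℂ z ^ m = z) (x : Quaternion ℝ) :
    conjPow m (Quaternion.ofComplex z * x) = Quaternion.ofComplex z * conjPow m x := by
  have h : (⟨(Quaternion.ofComplex z * x).re, (Quaternion.ofComplex z * x).imI⟩ : ℂ) = z * ⟨x.re, x.imI⟩ := by
    apply Complex.ext <;> simp
  have h2 : starRingEnd ℂ ⟨(Quaternion.ofComplex z * x).re, (Quaternion.ofComplex z * x).imI⟩ ^ m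
      = z * starRingEnd ℂ ⟨x.re, x.imI⟩ ^ m := by
    rw [h, map_mul, mul_pow, hz]
  have hre (y : Quaternion ℝ) : (conjPow m y).re = (starRingEnd ℂ ⟨y.re, y.imI⟩ ^ m).re := rfl
  have hi (y : Quaternion ℝ) : (conjPow m y).imI = (starRingEnd ℂ ⟨y.re, y.imI⟩ ^ m).im := rfl
  have hj (y : Quaternion ℝ) : (conjPow m y).imJ = y.imJ := rfl
  have hk (y : Quaternion ℝ) : (conjPow m y).imK = y.imK := rfl
  ext
  · rw [hre, h2, Quaternion.re_mul, hre, hi, hj, hk]; simp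
  · rw [hi, h2, Quaternion.imI_mul, hre, hi, hj, hk]; simp
  · rw [hj, Quaternion.imJ_mul, Quaternion.imJ_mul, hre, hi, hj, hk]; simp
  · rw [hk, Quaternion.imK_mul, Quaternion.imK_mul, hre, hi, hj, hk]; simp

theorem conjPowMap_mul {m : ℕ} {z : ℂ} (hz : ‖z‖ = 1) (h : starRingEnd ℂ z ^ m = z) (x : S3) :
    conjPowMap m (rootOfUnity z hz * x) = rootOfUnity z hz * conjPowMap m x := by
  have h0 := conjPow_ne_zero m (S3_ne x)
  refine nrm_eq_of_pos _ _ _ ‖conjPow m x‖ (norm_pos_iff.2 h0) _ ?_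
  change conjPow m (Quaternion.ofComplex z * x) = ‖conjPow m x‖ • (Quaternion.ofComplex z * (‖conjPow m x‖⁻¹ • conjPow m x))
  rw [conjPow_ofComplex_mul h, mul_smul_comm, smul_inv_smul₀ (norm_ne_zero_iff.2 h0)]

/-- The class of the identity has infinite order. -/
theorem unitClass_pow_ne_one {n : ℕ} (hn : n ≠ 0) : unitClass ^ n ≠ 1 := by
  intro h
  have : NeZero n := ⟨hn⟩
  have hp := Complex.isPrimitiveRoot_exp n hn
  set z := Complex.exp (2 * Real.pi * Complex.I / n)
  have hz : ‖z‖ = 1 := hp.norm'_eq_one hn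
  have hc : starRingEnd ℂ z ^ (n - 1) = z := by
    rw [← Complex.inv_eq_conj hz, inv_pow]
    refine inv_eq_of_mul_eq_one_left ?_
    rw [← pow_succ', Nat.sub_add_cancel (Nat.pos_of_ne_zero hn), hp.pow_eq_one]
  obtain ⟨D, hD, e⟩ := cls_mem_zpowers_of_equivariant (orderOf_rootOfUnity hp hz) (conjPowMap_mul hz hc)
  rw [h, Subgroup.zpowers_one_eq_bot, Subgroup.mem_bot] at hD
  rw [hD, mul_one, unitClass, cls_eq_iff] at e
  exact not_conjPowMap_homotopic_id _ e

variable {p : ℕ} [Fact p.Prime]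

theorem exists_cls_act_eq {act : ZMod p → S3 → S3} (h : IsFreeAct act) (g : ZMod p) :
    ∃ k : ℤ, cls ⟨act g, h.cont g⟩ = unitClass ^ (1 + p * k) := by
  have hp := (Fact.out : p.Prime)
  have hsucc : ∀ j : ℕ, cls ⟨act ((j + 1 : ℕ) : ZMod p), h.cont _⟩ =
      pull ⟨act (j : ZMod p), h.cont _⟩ (cls ⟨act 1, h.cont 1⟩) := by
    intro j
    rw [pull_cls]
    congr 1
    ext1 x
    change act ((j + 1 : ℕ) : ZMod p) x = act 1 (act j x)
    rw [← h.add, Nat.cast_add, Nat.cast_one, add_comm]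
  have hzero : cls ⟨act ((0 : ℕ) : ZMod p), h.cont _⟩ = unitClass := by
    rw [unitClass]
    congr 1
    ext1 x
    change act ((0 : ℕ) : ZMod p) x = x
    rw [Nat.cast_zero, h.zero]
  obtain ⟨m, hm⟩ := exists_zpow_unitClass ⟨act 1, h.cont 1⟩
  have hpow : ∀ j : ℕ, cls ⟨act (j : ZMod p), h.cont _⟩ = unitClass ^ (m ^ j) := by
    intro j
    induction j with
    | zero => rw [hzero, pow_zero, zpow_one]
    | succ j ih => rw [hsucc, hm, map_zpow, pull_unitClass, ih, ← zpow_mul, pow_succ]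
  have hfermat : (p : ℤ) ∣ m ^ p - m := by
    rw [← ZMod.intCast_zmod_eq_zero_iff_dvd]
    simp
  obtain ⟨b, hb⟩ := hfermat
  have hone : unitClass ^ m = unitClass ^ (1 + p * -b) := by
    have h1 : unitClass ^ (m ^ p) = unitClass := by
      rw [← hpow, ← hzero]
      congr 3
      simp
    have h2 : m = m ^ p + p * -b := by linarith
    rw [h2, zpow_add, h1, zpow_add, zpow_one]
  have key : ∀ j : ℕ, ∃ k : ℤ, cls ⟨act (j : ZMod p), h.cont _⟩ = unitClass ^ (1 + p * k) := by
    intro j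
    induction j with
    | zero => exact ⟨0, by rw [hzero, mul_zero, add_zero, zpow_one]⟩
    | succ j ih =>
      obtain ⟨k, hk⟩ := ih
      refine ⟨k + -b + p * k * -b, ?_⟩
      rw [hsucc, hm, hone, map_zpow, pull_unitClass, hk, ← zpow_mul]
      congr 1
      ring
  obtain ⟨k, hk⟩ := key g.val
  refine ⟨k, ?_⟩
  rw [← hk]
  congr 3
  simp

theorem cls_mem_of_prime_invariant {act : ZMod p → S3 → S3} (h : IsFreeAct act) {f : C(S3, S3)}
    (hf : ∀ g x, f (act g x) = f x) : cls f ∈ Subgroup.zpowers (unitClass ^ p) := by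
  refine cls_mem_of_invariant h _ (fun q => ?_) f hf
  obtain ⟨n, hn⟩ := exists_zpow_unitClass q
  have key : ∀ l : List (ZMod p), ∃ k : ℤ, (l.map fun g => cls (q.comp ⟨act g, h.cont g⟩)).prod =
      unitClass ^ (l.length * n + p * k) := by
    intro l
    induction l with
    | nil => exact ⟨0, by simp⟩
    | cons g l ih =>
      obtain ⟨k, hk⟩ := ih
      obtain ⟨a, ha⟩ := exists_cls_act_eq h g
      refine ⟨k + a * n, ?_⟩
      rw [List.map_cons, List.prod_cons, hk, ← pull_cls, hn, map_zpow, pull_unitClass, ha, ← zpow_mul, ← zpow_add]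
      congr 1
      push_cast [List.length_cons]
      ring
  obtain ⟨k, hk⟩ := key Finset.univ.toList
  rw [hk, Finset.length_toList, Finset.card_univ, ZMod.card]
  exact ⟨n + k, by dsimp only; rw [← zpow_natCast, ← zpow_mul, mul_add]⟩

theorem not_isFreeAct (act : ZMod p × ZMod p → S3 → S3) : ¬ IsFreeAct act := by
  intro h
  have hp := (Fact.out : p.Prime)
  have hprim := Complex.isPrimitiveRoot_exp p hp.ne_zero
  have hw := orderOf_rootOfUnity hprim (hprim.norm'_eq_one hp.ne_zero)
  set w := rootOfUnity _ (hprim.norm'_eq_one hp.ne_zero)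
  have hfree := isFreeAct_pow_mul hw
  have hK : IsFreeAct fun (j : ZMod p) => act (0, j) :=
    ⟨fun g => h.cont _, h.zero, fun g k x => by rw [← h.add]; simp, fun g hg => h.free _ (by simpa using hg)⟩
  obtain ⟨f, hf⟩ := exists_equivariant h (fun g x => w ^ g.1.val * x) (fun g => hfree.cont g.1) hfree.zero
    (fun g k => hfree.add g.1 k.1)
  obtain ⟨e, he⟩ := exists_equivariant hfree (fun j => act (j, 0)) (fun g => h.cont _) h.zero
    (fun g k x => by rw [← h.add]; simp)
  obtain ⟨k, hk⟩ := cls_mem_of_prime_invariant hK (f := f) fun g x => by rw [hf]; simp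
  obtain ⟨D, ⟨d, hd⟩, hD⟩ := cls_mem_zpowers_of_equivariant hw (F := f.comp e) fun x => by
    have h1 := he 1 x
    have h2 := hf (1, 0) (e x)
    simp only [ZMod.val_one, pow_one] at h1 h2
    simp only [ContinuousMap.comp_apply, h1, h2]
  obtain ⟨a, ha⟩ := exists_zpow_unitClass e
  dsimp only at hk hd
  rw [← pull_cls, ← hk, map_zpow, map_pow, pull_unitClass, ha, ← hd, ← zpow_natCast, ← zpow_natCast, ← zpow_mul,
    ← zpow_mul, ← zpow_mul, ← zpow_one_add] at hD
  have h3 : unitClass ^ (a * (p * k) - (1 + p * d)) = 1 := by rw [zpow_sub, hD, mul_inv_cancel]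
  have h4 : a * (p * k) - (1 + p * d) ≠ 0 := by
    intro h5
    have : (p : ℤ) ∣ 1 := ⟨a * k - d, by linarith⟩
    exact hp.one_lt.ne' (by exact_mod_cast Int.eq_one_of_dvd_one (by positivity) this)
  refine unitClass_pow_ne_one (Int.natAbs_ne_zero.2 h4) ?_
  rwa [pow_natAbs_eq_one]

end

end QuaternionSphere

/-- No free action of `ℤ/p × ℤ/p` (p prime) on the 3-sphere by homeomorphisms: there is no
additive action of `ZMod p × ZMod p` on `S³ ⊆ ℝ⁴` by continuous maps (equivalently, by
homeomorphisms, since each `act g` has continuous inverse `act (-g)`) in which every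
nonidentity element acts without fixed points. -/
theorem no_free_ZpZp_action_on_S3 (p : ℕ) (hp : p.Prime) :
    ¬ ∃ act : ZMod p × ZMod p →
        (Metric.sphere (0 : EuclideanSpace ℝ (Fin 4)) 1 →
          Metric.sphere (0 : EuclideanSpace ℝ (Fin 4)) 1),
      (∀ g, Continuous (act g)) ∧
      act 0 = id ∧
      (∀ g h, act (g + h) = act g ∘ act h) ∧
      (∀ g, g ≠ 0 → ∀ x, act g x ≠ x) := by
  rintro ⟨act, hc, hz, hadd, hfree⟩
  have : Fact p.Prime := ⟨hp⟩
  let E := Quaternion.linearIsometryEquivTuple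
  let e : QuaternionSphere.S3 ≃ₜ Metric.sphere (0 : EuclideanSpace ℝ (Fin 4)) 1 := E.toHomeomorph.sets (by
    ext x
    simp)
  refine QuaternionSphere.not_isFreeAct (p := p) (fun g x => e.symm (act g (e x))) ⟨fun g => ?_, fun x => ?_, fun g h x => ?_, ?_⟩
  · exact e.symm.continuous.comp ((hc g).comp e.continuous)
  · simp [hz]
  · simp [hadd]
  · intro g hg x hx
    exact hfree g hg (e x) (e.symm_apply_eq.1 hx)
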